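/- arXiv:1903.02141 — 11 statements merged into one kernel-verified Lean document; each statement's English description precedes it below -/
import Mathlib

section
/- Let κ : k → g be a morphism of Lie algebras over a field K of characteristic 0 admitting a linear section s : g → k with κ ∘ s = id_g, and let M : k ×_g k → k be defined by M(t,t') = t + t' − s(κ(t)). If M is a morphism of Lie algebras, where the fiber product k ×_g k = {(t,t') : κ(t) = κ(t')} carries the componentwise bracket [(t,t'),(r,r')] = ([t,r],[t',r']), then the kernel of κ is abelian: [k₁,k₂] = 0 for all k₁, k₂ ∈ ker(κ). -/
/-- Let `κ : k → g` be a morphism of Lie algebras over a field `K` of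
characteristic `0`, admitting a linear section `s` with `κ ∘ s = id`, and let
`M(t,t') = t + t' - s(κ t)` on the fiber product `{(t,t') : κ t = κ t'}` (which carries
the componentwise bracket).  If `M` is a morphism of Lie algebras, then `ker κ` is
abelian:  `⁅k₁, k₂⁆ = 0` for all `k₁, k₂ ∈ ker κ`. -/
theorem ker_abelian_of_mul_isLieHom {K k g : Type*} [Field K] [CharZero K]
    [LieRing k] [LieAlgebra K k] [LieRing g] [LieAlgebra K g]
    (κ : k →ₗ⁅K⁆ g) (s : g →ₗ[K] k) (hs : ∀ x, κ (s x) = x)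
    (hM : ∀ t t' r r' : k, κ t = κ t' → κ r = κ r' →
      ⁅t, r⁆ + ⁅t', r'⁆ - s (κ ⁅t, r⁆) = ⁅t + t' - s (κ t), r + r' - s (κ r)⁆) :
    ∀ k₁ k₂ : k, κ k₁ = 0 → κ k₂ = 0 → ⁅k₁, k₂⁆ = 0 := by
  intro k₁ k₂ h₁ h₂
  simpa [h₁] using (hM k₁ 0 0 k₂ (by simp [h₁]) (by simp [h₂])).symm
end

section
/- Let (g, φ) be a LieDer pair over a field K of characteristic 0 with Lie bracket ω, and let (ω_i)_{i≥0} (skew-symmetric bilinear maps g × g → g with ω_0 = ω) and (φ_i)_{i≥0} (linear maps g → g with φ_0 = φ) be a 1-parameter formal deformation of (g, φ), i.e. for every n ≥ 0 and all x,y,z ∈ g: Σ_{i+j=n} (ω_i(ω_j(x,y),z) + ω_i(ω_j(y,z),x) + ω_i(ω_j(z,x),y)) = 0 and Σ_{i+j=n} (φ_i(ω_j(x,y)) − ω_j(φ_i(x),y) − ω_j(x,φ_i(y))) = 0. Then the infinitesimal (ω_1, φ_1) is a 2-cocycle of the LieDer pair (g, φ) with coefficients in the adjoint representation: d ω_1 =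 0 and d φ_1 + δ ω_1 = 0. -/
/-- Let `(g, φ)` be a LieDer pair over a field `K` of characteristic `0`
with bracket `ω`, and let `(ωᵢ, φᵢ)_{i≥0}` be a 1-parameter formal deformation of
`(g, φ)` (skew-symmetric bilinear `ωᵢ` with `ω₀ = ω`, linear `φᵢ` with `φ₀ = φ`,
satisfying the deformation equations for every `n ≥ 0`).  Then the infinitesimal
`(ω₁, φ₁)` is a 2-cocycle of the LieDer pair with adjoint coefficients:
`d ω₁ = 0` and `d φ₁ + δ ω₁ = 0`. -/
theorem infinitesimal_is_cocycle {K g : Type*} [Field K] [CharZero K]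
    [LieRing g] [LieAlgebra K g]
    (φ : g →ₗ[K] g) (hφ : ∀ x y : g, φ ⁅x, y⁆ = ⁅φ x, y⁆ + ⁅x, φ y⁆)
    (ω : ℕ → g →ₗ[K] g →ₗ[K] g) (φd : ℕ → g →ₗ[K] g)
    (hω0 : ∀ x y : g, ω 0 x y = ⁅x, y⁆) (hφ0 : φd 0 = φ)
    (hskew : ∀ (i : ℕ) (x y : g), ω i x y = - ω i y x)
    (hdef1 : ∀ (n : ℕ) (x y z : g),
      ∑ i ∈ Finset.range (n + 1),
        (ω i (ω (n - i) x y) z + ω i (ω (n - i) y z) x + ω i (ω (n - i) z x) y) = 0)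
    (hdef2 : ∀ (n : ℕ) (x y : g),
      ∑ i ∈ Finset.range (n + 1),
        (φd i (ω (n - i) x y) - ω (n - i) (φd i x) y - ω (n - i) x (φd i y)) = 0) :
    -- d ω₁ = 0
    (∀ x y z : g,
      ⁅x, ω 1 y z⁆ - ⁅y, ω 1 x z⁆ + ⁅z, ω 1 x y⁆
        - ω 1 ⁅x, y⁆ z + ω 1 ⁅x, z⁆ y - ω 1 ⁅y, z⁆ x = 0) ∧
    -- d φ₁ + δ ω₁ = 0
    (∀ x y : g,
      (⁅x, φd 1 y⁆ - ⁅y, φd 1 x⁆ - φd 1 ⁅x, y⁆)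
        + (ω 1 (φ x) y + ω 1 x (φ y) - φ (ω 1 x y)) = 0) := by
  constructor
  · intro x y z
    have h := hdef1 1 x y z
    simp only [Finset.sum_range_succ, Finset.sum_range_zero, hω0, zero_add, Nat.sub_zero,
      Nat.sub_self] at h
    rw [hskew 1 z x, ← lie_skew z x, map_neg, LinearMap.neg_apply, neg_lie,
      ← lie_skew (ω 1 x y) z, ← lie_skew (ω 1 y z) x, ← lie_skew (ω 1 x z) y] at h
    rw [← neg_eq_zero, ← h]
    abel
  · intro x y
    have h := hdef2 1 x y
    simp only [Finset.sum_range_succ, Finset.sum_range_zero, hω0, hφ0, zero_add, Nat.sub_zero,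
      Nat.sub_self] at h
    rw [← lie_skew (φd 1 x) y] at h
    rw [← neg_eq_zero, ← h]
    abel
end

section
/- Let (g, φ) be a LieDer pair over a field K of characteristic 0 with bracket ω, and let (ω̄_i, φ̄_i)_{i≥0} and (ω_i, φ_i)_{i≥0} be two 1-parameter formal deformations of (g, φ). Suppose (ϕ_i)_{i≥0} is a formal isomorphism from the first to the second, i.e. ϕ_0 = id_g and for every n ≥ 0 and all x,y ∈ g: Σ_{i+j=n} ϕ_i(ω̄_j(x,y)) = Σ_{i+j+k=n} ω_i(ϕ_j(x), ϕ_k(y)) and Σ_{i+j=n} ϕ_i(φ̄_j(x)) = Σ_{i+j=n} φ_i(ϕ_j(x)). Then the infinitesimals are cohomologous: ω̄_1(x,y) = ω_1(x,y) + ω(ϕ_1(x),y) + ω(x,ϕ_1(y)) − ϕ_1(ω(x,y)) and φ̄_1(x) = φ_1(x) + φ(ϕ_1(x)) − ϕ_1(φ(x)), i.e. (ω̄_1, φ̄_1) = (ω_1, φ_1) + ∂(ϕ_1). -/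
/-- Let `(g, φ)` be a LieDer pair over a field `K` of characteristic `0`
with bracket `ω`, and let `(ω̄ᵢ, φ̄ᵢ)` and `(ωᵢ, φᵢ)` be 1-parameter formal deformations
of `(g, φ)`.  If `(ϕᵢ)_{i≥0}` with `ϕ₀ = id` is a formal isomorphism from the first to
the second, then the infinitesimals are cohomologous:
`ω̄₁ = ω₁ + ∂(ϕ₁)`-part and `φ̄₁ = φ₁ − δϕ₁`-part, explicitly
`ω̄₁(x,y) = ω₁(x,y) + ω(ϕ₁x, y) + ω(x, ϕ₁y) − ϕ₁(ω(x,y))` and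
`φ̄₁(x) = φ₁(x) + φ(ϕ₁x) − ϕ₁(φx)`. -/
theorem equivalent_deformations_cohomologous {K g : Type*} [Field K] [CharZero K]
    [LieRing g] [LieAlgebra K g]
    (φ : g →ₗ[K] g) (hφ : ∀ x y : g, φ ⁅x, y⁆ = ⁅φ x, y⁆ + ⁅x, φ y⁆)
    -- the deformation (ω̄ᵢ, φ̄ᵢ)
    (ωb : ℕ → g →ₗ[K] g →ₗ[K] g) (φb : ℕ → g →ₗ[K] g)
    (hωb0 : ∀ x y : g, ωb 0 x y = ⁅x, y⁆) (hφb0 : φb 0 = φ)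
    (hskewb : ∀ (i : ℕ) (x y : g), ωb i x y = - ωb i y x)
    (hdefb1 : ∀ (n : ℕ) (x y z : g),
      ∑ i ∈ Finset.range (n + 1),
        (ωb i (ωb (n - i) x y) z + ωb i (ωb (n - i) y z) x + ωb i (ωb (n - i) z x) y) = 0)
    (hdefb2 : ∀ (n : ℕ) (x y : g),
      ∑ i ∈ Finset.range (n + 1),
        (φb i (ωb (n - i) x y) - ωb (n - i) (φb i x) y - ωb (n - i) x (φb i y)) = 0)
    -- the deformation (ωᵢ, φᵢ)
    (ω : ℕ → g →ₗ[K] g →ₗ[K] g) (φd : ℕ → g →ₗ[K] g)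
    (hω0 : ∀ x y : g, ω 0 x y = ⁅x, y⁆) (hφ0 : φd 0 = φ)
    (hskew : ∀ (i : ℕ) (x y : g), ω i x y = - ω i y x)
    (hdef1 : ∀ (n : ℕ) (x y z : g),
      ∑ i ∈ Finset.range (n + 1),
        (ω i (ω (n - i) x y) z + ω i (ω (n - i) y z) x + ω i (ω (n - i) z x) y) = 0)
    (hdef2 : ∀ (n : ℕ) (x y : g),
      ∑ i ∈ Finset.range (n + 1),
        (φd i (ω (n - i) x y) - ω (n - i) (φd i x) y - ω (n - i) x (φd i y)) = 0)
    -- the formal isomorphism Φ_t = Σ ϕᵢ tⁱ from (ω̄, φ̄) to (ω, φ)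
    (ϕ : ℕ → g →ₗ[K] g) (hϕ0 : ϕ 0 = LinearMap.id)
    (hiso1 : ∀ (n : ℕ) (x y : g),
      ∑ i ∈ Finset.range (n + 1), ϕ i (ωb (n - i) x y) =
        ∑ i ∈ Finset.range (n + 1), ∑ j ∈ Finset.range (n + 1 - i),
          ω i (ϕ j x) (ϕ (n - i - j) y))
    (hiso2 : ∀ (n : ℕ) (x : g),
      ∑ i ∈ Finset.range (n + 1), ϕ i (φb (n - i) x) =
        ∑ i ∈ Finset.range (n + 1), φd i (ϕ (n - i) x)) :
    (∀ x y : g, ωb 1 x y = ω 1 x y + ⁅ϕ 1 x, y⁆ + ⁅x, ϕ 1 y⁆ - ϕ 1 ⁅x, y⁆) ∧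
    (∀ x : g, φb 1 x = φd 1 x + φ (ϕ 1 x) - ϕ 1 (φ x)) := by
  constructor
  · intro x y
    have h := hiso1 1 x y
    simp only [Nat.reduceAdd, Finset.sum_range_succ, Finset.sum_range_zero, zero_add,
      Nat.sub_zero, Nat.sub_self, Nat.add_one_sub_one, hϕ0, hω0, hωb0,
      LinearMap.id_apply] at h
    rw [eq_sub_iff_add_eq, h]
    abel
  · intro x
    have h := hiso2 1 x
    simp only [Nat.reduceAdd, Finset.sum_range_succ, Finset.sum_range_zero, zero_add,
      Nat.sub_zero, Nat.sub_self, hϕ0, hφ0, hφb0, LinearMap.id_apply] at h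
    rw [eq_sub_iff_add_eq, h, add_comm]
end

section
/- Let (g, φ) be a LieDer pair over a field K of characteristic 0 with bracket ω. Suppose the second LieDer cohomology with adjoint coefficients vanishes, i.e. every 2-cocycle (f, h) ∈ C^2(g;g) × C^1(g;g) (meaning d f = 0 and d h + δ f = 0) is of the form (d ϕ, −δ ϕ) for some linear ϕ : g → g. Then (g, φ) is rigid: for every 1-parameter formal deformation (ω_i, φ_i)_{i≥0} of (g, φ) there exists a family of linear maps (ϕ_i)_{i≥0} with ϕ_0 = id_g such that for every n ≥ 0 and all x,y ∈ g: Σ_{i+j=n} ϕ_i(ω_j(x,y)) = Σ_{i+j=n} ω(ϕ_i(x), ϕ_j(y)) and Σ_{i+j=n} ϕ_i(φ_j(x)) = φ(ϕ_n(x)), i.e. the deformation is equivalent to the trivial one (ω, φ). -/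
open Finset in
theorem sum_antidiagonal_assoc {M : Type*} [AddCommMonoid M] (F : ℕ → ℕ → ℕ → M) (n : ℕ) :
    ∑ p ∈ antidiagonal n, ∑ q ∈ antidiagonal p.1, F q.1 q.2 p.2 =
      ∑ p ∈ antidiagonal n, ∑ q ∈ antidiagonal p.2, F p.1 q.1 q.2 := by
  rw [sum_sigma', sum_sigma']
  refine sum_nbij' (fun s => ⟨(s.2.1, s.2.2 + s.1.2), (s.2.2, s.1.2)⟩)
    (fun s => ⟨(s.1.1 + s.2.1, s.2.2), (s.1.1, s.2.1)⟩) ?_ ?_ ?_ ?_ ?_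
  · rintro ⟨⟨a, b⟩, ⟨c, d⟩⟩ h
    simp only [mem_sigma, HasAntidiagonal.mem_antidiagonal] at h ⊢
    obtain ⟨rfl, rfl⟩ := h
    exact ⟨by ring, trivial⟩
  · rintro ⟨⟨a, b⟩, ⟨c, d⟩⟩ h
    simp only [mem_sigma, HasAntidiagonal.mem_antidiagonal] at h ⊢
    obtain ⟨rfl, rfl⟩ := h
    exact ⟨by ring, trivial⟩
  · rintro ⟨⟨a, b⟩, ⟨c, d⟩⟩ h
    simp only [mem_sigma, HasAntidiagonal.mem_antidiagonal] at h
    obtain ⟨rfl, rfl⟩ := h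
    rfl
  · rintro ⟨⟨a, b⟩, ⟨c, d⟩⟩ h
    simp only [mem_sigma, HasAntidiagonal.mem_antidiagonal] at h
    obtain ⟨rfl, rfl⟩ := h
    rfl
  · rintro ⟨⟨a, b⟩, ⟨c, d⟩⟩ h
    rfl

open Finset in
theorem sum_antidiagonal_comm {M : Type*} [AddCommMonoid M] (F : ℕ → ℕ → M) (n : ℕ) :
    ∑ p ∈ antidiagonal n, F p.1 p.2 = ∑ p ∈ antidiagonal n, F p.2 p.1 :=
  (Nat.sum_antidiagonal_swap (n := n) (f := fun p => F p.1 p.2)).symm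

open Finset in
theorem sum_antidiagonal_exchange {M : Type*} [AddCommMonoid M] (F : ℕ → ℕ → ℕ → M) (n : ℕ) :
    ∑ p ∈ antidiagonal n, ∑ q ∈ antidiagonal p.1, F q.1 q.2 p.2 =
      ∑ p ∈ antidiagonal n, ∑ q ∈ antidiagonal p.1, F q.1 p.2 q.2 := by
  rw [sum_antidiagonal_assoc, sum_antidiagonal_assoc (fun k i j => F k j i)]
  exact sum_congr rfl fun p _ => sum_antidiagonal_comm (F p.1) p.2

open Finset in
theorem sum_antidiagonal_rotate {M : Type*} [AddCommMonoid M] (F : ℕ → ℕ → ℕ → M) (n : ℕ) :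
    ∑ p ∈ antidiagonal n, ∑ q ∈ antidiagonal p.1, F q.1 q.2 p.2 =
      ∑ p ∈ antidiagonal n, ∑ q ∈ antidiagonal p.1, F p.2 q.1 q.2 := by
  rw [sum_antidiagonal_assoc]
  exact sum_antidiagonal_comm (fun k m => ∑ q ∈ antidiagonal m, F k q.1 q.2) n

open Finset in
theorem sum_antidiagonal_eq_top {M : Type*} [AddCommMonoid M] {F : ℕ → ℕ → M} {n : ℕ}
    (hF : ∀ m < n, ∀ j, F m j = 0) : ∑ p ∈ antidiagonal n, F p.1 p.2 = F n 0 := by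
  refine sum_eq_single (n, 0) ?_ (by simp)
  rintro ⟨a, b⟩ h hne
  rw [HasAntidiagonal.mem_antidiagonal] at h
  refine hF a (lt_of_le_of_ne (by omega) ?_) b
  rintro rfl
  exact hne (Prod.ext rfl (by omega))

namespace LieDerDeformation

open Finset

variable {K g : Type*} [Field K] [LieRing g] [LieAlgebra K g]

/-- The coefficient of order `n` of `Φ (ω_t (x, y)) - [Φ x, Φ y]`, where `Φ = ∑ ϕᵢ tⁱ`. -/
def bracketDefect (ω : ℕ → g →ₗ[K] g →ₗ[K] g) (ϕ : ℕ → g →ₗ[K] g) (n : ℕ) :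
    g →ₗ[K] g →ₗ[K] g :=
  ∑ p ∈ antidiagonal n, ((ω p.2).compr₂ (ϕ p.1) -
    (LieModule.toEnd K g g : g →ₗ[K] g →ₗ[K] g).compl₁₂ (ϕ p.1) (ϕ p.2))

/-- The coefficient of order `n` of `Φ (φ_t x) - φ (Φ x)`, where `Φ = ∑ ϕᵢ tⁱ`. -/
def derivationDefect (φ : g →ₗ[K] g) (φd ϕ : ℕ → g →ₗ[K] g) (n : ℕ) : g →ₗ[K] g :=
  ∑ p ∈ antidiagonal n, ϕ p.1 ∘ₗ φd p.2 - φ ∘ₗ ϕ n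

theorem bracketDefect_apply (ω : ℕ → g →ₗ[K] g →ₗ[K] g) (ϕ : ℕ → g →ₗ[K] g) (n : ℕ) (x y : g) :
    bracketDefect ω ϕ n x y = ∑ p ∈ antidiagonal n, ϕ p.1 (ω p.2 x y) -
      ∑ p ∈ antidiagonal n, ⁅ϕ p.1 x, ϕ p.2 y⁆ := by
  simp [bracketDefect, LinearMap.sum_apply]

theorem derivationDefect_apply (φ : g →ₗ[K] g) (φd ϕ : ℕ → g →ₗ[K] g) (n : ℕ) (x : g) :
    derivationDefect φ φd ϕ n x =
      ∑ p ∈ antidiagonal n, ϕ p.1 (φd p.2 x) - φ (ϕ n x) := by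
  simp [derivationDefect, LinearMap.sum_apply]

variable {φ : g →ₗ[K] g} {ω : ℕ → g →ₗ[K] g →ₗ[K] g} {φd ϕ : ℕ → g →ₗ[K] g} {n : ℕ}

theorem sum_map_bracket (m : ℕ) (x y : g) : ∑ p ∈ antidiagonal m, ϕ p.1 (ω p.2 x y) =
    bracketDefect ω ϕ m x y + ∑ p ∈ antidiagonal m, ⁅ϕ p.1 x, ϕ p.2 y⁆ := by
  rw [bracketDefect_apply, sub_add_cancel]

theorem sum_map_derivation (φ : g →ₗ[K] g) (m : ℕ) (x : g) :
    ∑ p ∈ antidiagonal m, ϕ p.1 (φd p.2 x) = derivationDefect φ φd ϕ m x + φ (ϕ m x) := by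
  rw [derivationDefect_apply, sub_add_cancel]

theorem bracketDefect_skew (hskew : ∀ (i : ℕ) (x y : g), ω i x y = - ω i y x) (n : ℕ) (x y : g) :
    bracketDefect ω ϕ n x y = - bracketDefect ω ϕ n y x := by
  have h : ∑ p ∈ antidiagonal n, ⁅ϕ p.1 x, ϕ p.2 y⁆ =
      - ∑ p ∈ antidiagonal n, ⁅ϕ p.1 y, ϕ p.2 x⁆ := by
    rw [sum_antidiagonal_comm (fun i j => ⁅ϕ i x, ϕ j y⁆), ← sum_neg_distrib]
    exact sum_congr rfl fun p _ => (lie_skew _ _).symm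
  rw [bracketDefect_apply, bracketDefect_apply, h]
  simp only [hskew _ x y, map_neg, sum_neg_distrib]
  abel

theorem sum_map_bracket_bracket (hω0 : ∀ x y : g, ω 0 x y = ⁅x, y⁆)
    (hϕ0 : ϕ 0 = LinearMap.id) (hD : ∀ m < n, bracketDefect ω ϕ m = 0) (x y z : g) :
    ∑ p ∈ antidiagonal n, ϕ p.1 (∑ q ∈ antidiagonal p.2, ω q.1 (ω q.2 x y) z) =
      bracketDefect ω ϕ n ⁅x, y⁆ z + ⁅bracketDefect ω ϕ n x y, z⁆ +
        ∑ p ∈ antidiagonal n, ∑ q ∈ antidiagonal p.1, ⁅⁅ϕ q.1 x, ϕ q.2 y⁆, ϕ p.2 z⁆ := by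
  simp only [map_sum]
  rw [← sum_antidiagonal_assoc (fun k i j => ϕ k (ω i (ω j x y) z))]
  simp only [sum_map_bracket, sum_add_distrib]
  rw [sum_antidiagonal_eq_top (F := fun m j => bracketDefect ω ϕ m (ω j x y) z)
      (fun m hm j => by simp [hD m hm]),
    sum_antidiagonal_exchange (fun k i j => ⁅ϕ k (ω j x y), ϕ i z⁆)]
  simp only [← _root_.sum_lie, sum_map_bracket, add_lie, sum_add_distrib]
  rw [sum_antidiagonal_eq_top (F := fun m j => ⁅bracketDefect ω ϕ m x y, ϕ j z⁆)
      (fun m hm j => by simp [hD m hm]), hω0, hϕ0, LinearMap.id_apply, add_assoc]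

theorem sum_lie_lie_cyclic (ϕ : ℕ → g →ₗ[K] g) (n : ℕ) (x y z : g) :
    ∑ p ∈ antidiagonal n, ∑ q ∈ antidiagonal p.1, ⁅⁅ϕ q.1 x, ϕ q.2 y⁆, ϕ p.2 z⁆ +
      ∑ p ∈ antidiagonal n, ∑ q ∈ antidiagonal p.1, ⁅⁅ϕ q.1 y, ϕ q.2 z⁆, ϕ p.2 x⁆ +
      ∑ p ∈ antidiagonal n, ∑ q ∈ antidiagonal p.1, ⁅⁅ϕ q.1 z, ϕ q.2 x⁆, ϕ p.2 y⁆ = 0 := by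
  rw [sum_antidiagonal_rotate (fun i j k => ⁅⁅ϕ i y, ϕ j z⁆, ϕ k x⁆),
    sum_antidiagonal_rotate (fun i j k => ⁅⁅ϕ k y, ϕ i z⁆, ϕ j x⁆),
    sum_antidiagonal_rotate (fun i j k => ⁅⁅ϕ i z, ϕ j x⁆, ϕ k y⁆),
    ← sum_add_distrib, ← sum_add_distrib]
  refine sum_eq_zero fun p _ => ?_
  rw [← sum_add_distrib, ← sum_add_distrib]
  refine sum_eq_zero fun q _ => ?_
  rw [← neg_eq_zero, ← lie_jacobi (ϕ p.2 z) (ϕ q.1 x) (ϕ q.2 y),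
    ← lie_skew (ϕ p.2 z) ⁅_, _⁆, ← lie_skew (ϕ q.1 x) ⁅_, _⁆, ← lie_skew (ϕ q.2 y) ⁅_, _⁆]
  abel

theorem bracketDefect_cocycle (hω0 : ∀ x y : g, ω 0 x y = ⁅x, y⁆)
    (hJ : ∀ (n : ℕ) (x y z : g), ∑ p ∈ antidiagonal n,
      (ω p.1 (ω p.2 x y) z + ω p.1 (ω p.2 y z) x + ω p.1 (ω p.2 z x) y) = 0)
    (hϕ0 : ϕ 0 = LinearMap.id) (hD : ∀ m < n, bracketDefect ω ϕ m = 0) (x y z : g) :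
    bracketDefect ω ϕ n ⁅x, y⁆ z + ⁅bracketDefect ω ϕ n x y, z⁆ +
      (bracketDefect ω ϕ n ⁅y, z⁆ x + ⁅bracketDefect ω ϕ n y z, x⁆) +
      (bracketDefect ω ϕ n ⁅z, x⁆ y + ⁅bracketDefect ω ϕ n z x, y⁆) = 0 := by
  have h : ∑ p ∈ antidiagonal n, ϕ p.1 (∑ q ∈ antidiagonal p.2,
      (ω q.1 (ω q.2 x y) z + ω q.1 (ω q.2 y z) x + ω q.1 (ω q.2 z x) y)) = 0 := by
    simp [hJ]
  simp only [sum_add_distrib, map_add] at h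
  rw [sum_map_bracket_bracket hω0 hϕ0 hD, sum_map_bracket_bracket hω0 hϕ0 hD,
    sum_map_bracket_bracket hω0 hϕ0 hD] at h
  rw [← h, ← sub_eq_zero, ← neg_eq_zero, ← sum_lie_lie_cyclic ϕ n x y z]
  abel

theorem sum_map_derivation_bracket (hω0 : ∀ x y : g, ω 0 x y = ⁅x, y⁆)
    (hE : ∀ m < n, derivationDefect φ φd ϕ m = 0) (x y : g) :
    ∑ p ∈ antidiagonal n, ϕ p.1 (∑ q ∈ antidiagonal p.2, φd q.1 (ω q.2 x y)) =
      derivationDefect φ φd ϕ n ⁅x, y⁆ + φ (bracketDefect ω ϕ n x y) +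
        φ (∑ p ∈ antidiagonal n, ⁅ϕ p.1 x, ϕ p.2 y⁆) := by
  rw [add_assoc, ← map_add, ← sum_map_bracket]
  simp only [map_sum]
  rw [← sum_antidiagonal_assoc (fun k i j => ϕ k (φd i (ω j x y)))]
  simp only [sum_map_derivation φ, sum_add_distrib]
  rw [sum_antidiagonal_eq_top (F := fun m j => derivationDefect φ φd ϕ m (ω j x y))
      (fun m hm j => by simp [hE m hm]), hω0]

theorem sum_map_bracket_derivation (hφ0 : φd 0 = φ) (hϕ0 : ϕ 0 = LinearMap.id)
    (hD : ∀ m < n, bracketDefect ω ϕ m = 0)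
    (hE : ∀ m < n, derivationDefect φ φd ϕ m = 0) (x y : g) :
    ∑ p ∈ antidiagonal n, ϕ p.1 (∑ q ∈ antidiagonal p.2, ω q.2 (φd q.1 x) y) =
      bracketDefect ω ϕ n (φ x) y + ⁅derivationDefect φ φd ϕ n x, y⁆ +
        ∑ p ∈ antidiagonal n, ⁅φ (ϕ p.1 x), ϕ p.2 y⁆ := by
  simp only [map_sum]
  rw [← sum_antidiagonal_assoc (fun k i j => ϕ k (ω j (φd i x) y)),
    sum_antidiagonal_exchange (fun k i j => ϕ k (ω j (φd i x) y))]
  simp only [sum_map_bracket, sum_add_distrib]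
  rw [sum_antidiagonal_eq_top (F := fun m j => bracketDefect ω ϕ m (φd j x) y)
      (fun m hm j => by simp [hD m hm]),
    sum_antidiagonal_exchange (fun k i j => ⁅ϕ k (φd j x), ϕ i y⁆)]
  simp only [← _root_.sum_lie, sum_map_derivation φ, add_lie, sum_add_distrib]
  rw [sum_antidiagonal_eq_top (F := fun m j => ⁅derivationDefect φ φd ϕ m x, ϕ j y⁆)
      (fun m hm j => by simp [hE m hm]), hφ0, hϕ0, LinearMap.id_apply, add_assoc]

theorem derivationDefect_cocycle (hφ : ∀ x y : g, φ ⁅x, y⁆ = ⁅φ x, y⁆ + ⁅x, φ y⁆)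
    (hω0 : ∀ x y : g, ω 0 x y = ⁅x, y⁆) (hφ0 : φd 0 = φ)
    (hskew : ∀ (i : ℕ) (x y : g), ω i x y = - ω i y x)
    (hder : ∀ (n : ℕ) (x y : g), ∑ p ∈ antidiagonal n,
      (φd p.1 (ω p.2 x y) - ω p.2 (φd p.1 x) y - ω p.2 x (φd p.1 y)) = 0)
    (hϕ0 : ϕ 0 = LinearMap.id) (hD : ∀ m < n, bracketDefect ω ϕ m = 0)
    (hE : ∀ m < n, derivationDefect φ φd ϕ m = 0) (x y : g) :
    derivationDefect φ φd ϕ n ⁅x, y⁆ + φ (bracketDefect ω ϕ n x y) -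
      (bracketDefect ω ϕ n (φ x) y + ⁅derivationDefect φ φd ϕ n x, y⁆) +
      (bracketDefect ω ϕ n (φ y) x + ⁅derivationDefect φ φd ϕ n y, x⁆) = 0 := by
  have h : ∑ p ∈ antidiagonal n, ϕ p.1 (∑ q ∈ antidiagonal p.2,
      (φd q.1 (ω q.2 x y) - ω q.2 (φd q.1 x) y + ω q.2 (φd q.1 y) x)) = 0 := by
    refine sum_eq_zero fun p _ => ?_
    rw [← map_zero (ϕ p.1), ← hder p.2 x y]
    congr 1
    refine sum_congr rfl fun q _ => ?_
    rw [hskew _ x (φd q.1 y), sub_neg_eq_add]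
  simp only [sum_add_distrib, sum_sub_distrib, map_add, map_sub] at h
  rw [sum_map_derivation_bracket hω0 hE, sum_map_bracket_derivation hφ0 hϕ0 hD hE,
    sum_map_bracket_derivation hφ0 hϕ0 hD hE] at h
  have h' : φ (∑ p ∈ antidiagonal n, ⁅ϕ p.1 x, ϕ p.2 y⁆) =
      ∑ p ∈ antidiagonal n, ⁅φ (ϕ p.1 x), ϕ p.2 y⁆ -
        ∑ p ∈ antidiagonal n, ⁅φ (ϕ p.1 y), ϕ p.2 x⁆ := by
    rw [sum_antidiagonal_comm (fun i j => ⁅φ (ϕ i y), ϕ j x⁆), ← sum_sub_distrib, map_sum]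
    refine sum_congr rfl fun p _ => ?_
    rw [hφ, ← lie_skew (ϕ p.1 x) (φ _), sub_eq_add_neg]
  rw [h'] at h
  rw [← h]
  abel

theorem sum_antidiagonal_succ_ends {M : Type*} [AddCommMonoid M] (F : ℕ → ℕ → M) (k : ℕ) :
    ∑ p ∈ antidiagonal (k + 1), F p.1 p.2 =
      F 0 (k + 1) + ∑ p ∈ range k, F (p + 1) (k - p) + F (k + 1) 0 := by
  rw [Nat.sum_antidiagonal_eq_sum_range_succ, Nat.succ_eq_add_one, sum_range_succ, sum_range_succ',
    Nat.sub_self, Nat.sub_zero, add_comm (F 0 (k + 1))]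
  simp only [Nat.add_sub_add_right]

theorem bracketDefect_congr {ϕ' : ℕ → g →ₗ[K] g} (h : ∀ i ≤ n, ϕ i = ϕ' i) :
    bracketDefect ω ϕ n = bracketDefect ω ϕ' n :=
  sum_congr rfl fun p hp => by
    rw [h p.1 (HasAntidiagonal.antidiagonal.fst_le hp), h p.2 (HasAntidiagonal.antidiagonal.snd_le hp)]

theorem derivationDefect_congr {ϕ' : ℕ → g →ₗ[K] g} (h : ∀ i ≤ n, ϕ i = ϕ' i) :
    derivationDefect φ φd ϕ n = derivationDefect φ φd ϕ' n := by
  unfold derivationDefect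
  rw [h n le_rfl, sum_congr rfl fun p hp => by rw [h p.1 (HasAntidiagonal.antidiagonal.fst_le hp)]]

theorem bracketDefect_update (hω0 : ∀ x y : g, ω 0 x y = ⁅x, y⁆) (hϕ0 : ϕ 0 = LinearMap.id)
    (k : ℕ) (χ : g →ₗ[K] g) (x y : g) :
    bracketDefect ω (Function.update ϕ (k + 1) (ϕ (k + 1) + χ)) (k + 1) x y =
      bracketDefect ω ϕ (k + 1) x y - (⁅χ x, y⁆ + ⁅x, χ y⁆ - χ ⁅x, y⁆) := by
  have h₁ : ∀ p ∈ range k, Function.update ϕ (k + 1) (ϕ (k + 1) + χ) (p + 1) = ϕ (p + 1) :=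
    fun p hp => Function.update_of_ne (by have := mem_range.1 hp; omega) _ _
  have h₂ : ∀ p, Function.update ϕ (k + 1) (ϕ (k + 1) + χ) (k - p) = ϕ (k - p) :=
    fun p => Function.update_of_ne (by omega) _ _
  have h₃ : Function.update ϕ (k + 1) (ϕ (k + 1) + χ) 0 = ϕ 0 :=
    Function.update_of_ne (by omega) _ _
  have h₄ : ∑ p ∈ range k, Function.update ϕ (k + 1) (ϕ (k + 1) + χ) (p + 1) (ω (k - p) x y) =
      ∑ p ∈ range k, ϕ (p + 1) (ω (k - p) x y) :=
    sum_congr rfl fun p hp => by rw [h₁ p hp]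
  have h₅ : ∑ p ∈ range k, ⁅Function.update ϕ (k + 1) (ϕ (k + 1) + χ) (p + 1) x,
      Function.update ϕ (k + 1) (ϕ (k + 1) + χ) (k - p) y⁆ =
      ∑ p ∈ range k, ⁅ϕ (p + 1) x, ϕ (k - p) y⁆ :=
    sum_congr rfl fun p hp => by rw [h₁ p hp, h₂ p]
  simp only [bracketDefect_apply]
  rw [sum_antidiagonal_succ_ends (fun i j => Function.update ϕ (k + 1) _ i (ω j x y)),
    sum_antidiagonal_succ_ends (fun i j => ⁅Function.update ϕ (k + 1) _ i x,
      Function.update ϕ (k + 1) _ j y⁆), h₄, h₅,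
    sum_antidiagonal_succ_ends (fun i j => ϕ i (ω j x y)),
    sum_antidiagonal_succ_ends (fun i j => ⁅ϕ i x, ϕ j y⁆)]
  simp only [h₃, hϕ0, Function.update_self, LinearMap.add_apply, LinearMap.id_apply, hω0,
    add_lie, lie_add]
  abel

theorem derivationDefect_update (hφ0 : φd 0 = φ) (k : ℕ) (χ : g →ₗ[K] g) (x : g) :
    derivationDefect φ φd (Function.update ϕ (k + 1) (ϕ (k + 1) + χ)) (k + 1) x =
      derivationDefect φ φd ϕ (k + 1) x - (φ (χ x) - χ (φ x)) := by
  have h₁ : ∀ p ∈ range (k + 1), Function.update ϕ (k + 1) (ϕ (k + 1) + χ) p = ϕ p :=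
    fun p hp => Function.update_of_ne (by have := mem_range.1 hp; omega) _ _
  have h₂ : ∑ p ∈ range (k + 1),
      Function.update ϕ (k + 1) (ϕ (k + 1) + χ) p (φd (k + 1 - p) x) =
      ∑ p ∈ range (k + 1), ϕ p (φd (k + 1 - p) x) :=
    sum_congr rfl fun p hp => by rw [h₁ p hp]
  simp only [derivationDefect_apply]
  rw [Nat.sum_antidiagonal_eq_sum_range_succ
      (fun i j => Function.update ϕ (k + 1) (ϕ (k + 1) + χ) i (φd j x)),
    Nat.sum_antidiagonal_eq_sum_range_succ (fun i j => ϕ i (φd j x)),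
    sum_range_succ _ (k + 1), sum_range_succ _ (k + 1), h₂]
  simp only [Function.update_self, Nat.sub_self, hφ0, LinearMap.add_apply, map_add]
  abel

theorem exists_update_defect_eq_zero (hφ : ∀ x y : g, φ ⁅x, y⁆ = ⁅φ x, y⁆ + ⁅x, φ y⁆)
    (hH2 : ∀ f : g →ₗ[K] g →ₗ[K] g, (∀ x y : g, f x y = - f y x) →
      ∀ h : g →ₗ[K] g,
      (∀ x y z : g,
        ⁅x, f y z⁆ - ⁅y, f x z⁆ + ⁅z, f x y⁆
          - f ⁅x, y⁆ z + f ⁅x, z⁆ y - f ⁅y, z⁆ x = 0) →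
      (∀ x y : g,
        (⁅x, h y⁆ - ⁅y, h x⁆ - h ⁅x, y⁆)
          + (f (φ x) y + f x (φ y) - φ (f x y)) = 0) →
      ∃ ϕ : g →ₗ[K] g,
        (∀ x y : g, f x y = ⁅ϕ x, y⁆ + ⁅x, ϕ y⁆ - ϕ ⁅x, y⁆) ∧
        (∀ x : g, h x = φ (ϕ x) - ϕ (φ x)))
    (hω0 : ∀ x y : g, ω 0 x y = ⁅x, y⁆) (hφ0 : φd 0 = φ)
    (hskew : ∀ (i : ℕ) (x y : g), ω i x y = - ω i y x)
    (hJ : ∀ (n : ℕ) (x y z : g), ∑ p ∈ antidiagonal n,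
      (ω p.1 (ω p.2 x y) z + ω p.1 (ω p.2 y z) x + ω p.1 (ω p.2 z x) y) = 0)
    (hder : ∀ (n : ℕ) (x y : g), ∑ p ∈ antidiagonal n,
      (φd p.1 (ω p.2 x y) - ω p.2 (φd p.1 x) y - ω p.2 x (φd p.1 y)) = 0)
    (hϕ0 : ϕ 0 = LinearMap.id) (hD : ∀ m ≤ n, bracketDefect ω ϕ m = 0)
    (hE : ∀ m ≤ n, derivationDefect φ φd ϕ m = 0) :
    ∃ ψ : g →ₗ[K] g, bracketDefect ω (Function.update ϕ (n + 1) ψ) (n + 1) = 0 ∧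
      derivationDefect φ φd (Function.update ϕ (n + 1) ψ) (n + 1) = 0 := by
  have hD' : ∀ m < n + 1, bracketDefect ω ϕ m = 0 := fun m hm => hD m (Nat.lt_succ_iff.1 hm)
  have hE' : ∀ m < n + 1, derivationDefect φ φd ϕ m = 0 := fun m hm => hE m (Nat.lt_succ_iff.1 hm)
  obtain ⟨χ, hχ₁, hχ₂⟩ := hH2 (bracketDefect ω ϕ (n + 1)) (bracketDefect_skew hskew _)
    (derivationDefect φ φd ϕ (n + 1))
    (fun x y z => by
      have h := bracketDefect_cocycle hω0 hJ hϕ0 hD' x y z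
      rw [bracketDefect_skew hskew _ z x, ← lie_skew z x, map_neg, LinearMap.neg_apply,
        neg_lie] at h
      rw [← neg_eq_zero, ← h, ← lie_skew x (bracketDefect _ _ _ _ _),
        ← lie_skew y (bracketDefect _ _ _ _ _), ← lie_skew z (bracketDefect _ _ _ _ _)]
      abel)
    (fun x y => by
      have h := derivationDefect_cocycle hφ hω0 hφ0 hskew hder hϕ0 hD' hE' x y
      rw [bracketDefect_skew hskew _ (φ y) x] at h
      rw [← neg_eq_zero, ← h, ← lie_skew x (derivationDefect _ _ _ _ _),
        ← lie_skew y (derivationDefect _ _ _ _ _)]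
      abel)
  refine ⟨ϕ (n + 1) + χ, LinearMap.ext₂ fun x y => ?_, LinearMap.ext fun x => ?_⟩
  · rw [bracketDefect_update hω0 hϕ0, hχ₁, sub_self]
    rfl
  · rw [derivationDefect_update hφ0, hχ₂, sub_self]
    rfl

theorem exists_seq_of_update {α : Type*} (P : (ℕ → α) → ℕ → Prop) (a : ℕ → α)
    (hcongr : ∀ (s t : ℕ → α) (n : ℕ), (∀ i ≤ n, s i = t i) → P s n → P t n) (h0 : P a 0)
    (hstep : ∀ (s : ℕ → α) (n : ℕ), s 0 = a 0 → (∀ m ≤ n, P s m) →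
      ∃ b, P (Function.update s (n + 1) b) (n + 1)) :
    ∃ s : ℕ → α, s 0 = a 0 ∧ ∀ n, P s n := by
  classical
  have : Nonempty α := ⟨a 0⟩
  choose! b hb using hstep
  let S : ℕ → ℕ → α := Nat.rec a fun n s => Function.update s (n + 1) (b s n)
  have hS : ∀ n, S (n + 1) = Function.update (S n) (n + 1) (b (S n) n) := fun _ => rfl
  have hsucc : ∀ n, ∀ i ≤ n, S n i = S (n + 1) i := fun n i hi => by
    rw [hS, Function.update_of_ne (by omega)]
  have hP : ∀ n, S n 0 = a 0 ∧ ∀ m ≤ n, P (S n) m := by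
    intro n
    induction n with
    | zero =>
      refine ⟨rfl, fun m hm => ?_⟩
      obtain rfl := Nat.le_zero.1 hm
      exact h0
    | succ n ih =>
      refine ⟨(hsucc n 0 n.zero_le).symm.trans ih.1, fun m hm => ?_⟩
      rcases Nat.le_succ_iff.1 hm with hm | rfl
      · exact hcongr _ _ m (fun i hi => hsucc n i (hi.trans hm)) (ih.2 m hm)
      · exact hb (S n) n ih.1 ih.2
  have hdiag : ∀ n, ∀ i ≤ n, S n i = S i i := by
    intro n i hi
    induction n, hi using Nat.le_induction with
    | base => rfl
    | succ n hn ih => rw [← hsucc n i hn, ih]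
  exact ⟨fun n => S n n, rfl, fun n => hcongr _ _ n (hdiag n) ((hP n).2 n le_rfl)⟩

theorem exists_trivialization (hφ : ∀ x y : g, φ ⁅x, y⁆ = ⁅φ x, y⁆ + ⁅x, φ y⁆)
    (hH2 : ∀ f : g →ₗ[K] g →ₗ[K] g, (∀ x y : g, f x y = - f y x) →
      ∀ h : g →ₗ[K] g,
      (∀ x y z : g,
        ⁅x, f y z⁆ - ⁅y, f x z⁆ + ⁅z, f x y⁆
          - f ⁅x, y⁆ z + f ⁅x, z⁆ y - f ⁅y, z⁆ x = 0) →
      (∀ x y : g,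
        (⁅x, h y⁆ - ⁅y, h x⁆ - h ⁅x, y⁆)
          + (f (φ x) y + f x (φ y) - φ (f x y)) = 0) →
      ∃ ϕ : g →ₗ[K] g,
        (∀ x y : g, f x y = ⁅ϕ x, y⁆ + ⁅x, ϕ y⁆ - ϕ ⁅x, y⁆) ∧
        (∀ x : g, h x = φ (ϕ x) - ϕ (φ x)))
    (hω0 : ∀ x y : g, ω 0 x y = ⁅x, y⁆) (hφ0 : φd 0 = φ)
    (hskew : ∀ (i : ℕ) (x y : g), ω i x y = - ω i y x)
    (hJ : ∀ (n : ℕ) (x y z : g), ∑ p ∈ antidiagonal n,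
      (ω p.1 (ω p.2 x y) z + ω p.1 (ω p.2 y z) x + ω p.1 (ω p.2 z x) y) = 0)
    (hder : ∀ (n : ℕ) (x y : g), ∑ p ∈ antidiagonal n,
      (φd p.1 (ω p.2 x y) - ω p.2 (φd p.1 x) y - ω p.2 x (φd p.1 y)) = 0) :
    ∃ ϕ : ℕ → g →ₗ[K] g, ϕ 0 = LinearMap.id ∧ (∀ n, bracketDefect ω ϕ n = 0) ∧
      ∀ n, derivationDefect φ φd ϕ n = 0 := by
  obtain ⟨ϕ, hϕ0, hϕ⟩ := exists_seq_of_update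
    (fun ϕ n => bracketDefect ω ϕ n = 0 ∧ derivationDefect φ φd ϕ n = 0)
    (fun _ => (LinearMap.id : g →ₗ[K] g))
    (fun s t n hst h => ⟨bracketDefect_congr (ω := ω) hst ▸ h.1,
      derivationDefect_congr (φ := φ) (φd := φd) hst ▸ h.2⟩)
    ⟨LinearMap.ext₂ fun x y => by simp [bracketDefect_apply, hω0],
      LinearMap.ext fun x => by simp [derivationDefect_apply, hφ0]⟩
    (fun s n hs h => exists_update_defect_eq_zero hφ hH2 hω0 hφ0 hskew hJ hder hs
      (fun m hm => (h m hm).1) (fun m hm => (h m hm).2))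
  exact ⟨ϕ, hϕ0, fun n => (hϕ n).1, fun n => (hϕ n).2⟩

end LieDerDeformation


/-- Let `(g, φ)` be a LieDer pair over a field `K` of characteristic `0`
with bracket `ω`.  If the second LieDer cohomology with adjoint coefficients vanishes
(every 2-cocycle `(f, h)` is of the form `(d ϕ, −δ ϕ)`), then `(g, φ)` is rigid:
every 1-parameter formal deformation `(ωᵢ, φᵢ)` is equivalent to the trivial one
`(ω, φ)` via a formal isomorphism `(ϕᵢ)_{i≥0}` with `ϕ₀ = id`. -/
theorem rigid_of_H2_trivial {K g : Type*} [Field K] [CharZero K]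
    [LieRing g] [LieAlgebra K g]
    (φ : g →ₗ[K] g) (hφ : ∀ x y : g, φ ⁅x, y⁆ = ⁅φ x, y⁆ + ⁅x, φ y⁆)
    -- H²_{LieDer}(g;g) = 0: every 2-cocycle (f, h) is a coboundary (d ϕ, −δ ϕ)
    (hH2 : ∀ f : g →ₗ[K] g →ₗ[K] g, (∀ x y : g, f x y = - f y x) →
      ∀ h : g →ₗ[K] g,
      (∀ x y z : g,
        ⁅x, f y z⁆ - ⁅y, f x z⁆ + ⁅z, f x y⁆
          - f ⁅x, y⁆ z + f ⁅x, z⁆ y - f ⁅y, z⁆ x = 0) →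
      (∀ x y : g,
        (⁅x, h y⁆ - ⁅y, h x⁆ - h ⁅x, y⁆)
          + (f (φ x) y + f x (φ y) - φ (f x y)) = 0) →
      ∃ ϕ : g →ₗ[K] g,
        (∀ x y : g, f x y = ⁅ϕ x, y⁆ + ⁅x, ϕ y⁆ - ϕ ⁅x, y⁆) ∧
        (∀ x : g, h x = φ (ϕ x) - ϕ (φ x)))
    -- a 1-parameter formal deformation (ωᵢ, φᵢ)
    (ω : ℕ → g →ₗ[K] g →ₗ[K] g) (φd : ℕ → g →ₗ[K] g)
    (hω0 : ∀ x y : g, ω 0 x y = ⁅x, y⁆) (hφ0 : φd 0 = φ)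
    (hskew : ∀ (i : ℕ) (x y : g), ω i x y = - ω i y x)
    (hdef1 : ∀ (n : ℕ) (x y z : g),
      ∑ i ∈ Finset.range (n + 1),
        (ω i (ω (n - i) x y) z + ω i (ω (n - i) y z) x + ω i (ω (n - i) z x) y) = 0)
    (hdef2 : ∀ (n : ℕ) (x y : g),
      ∑ i ∈ Finset.range (n + 1),
        (φd i (ω (n - i) x y) - ω (n - i) (φd i x) y - ω (n - i) x (φd i y)) = 0) :
    -- the deformation is trivial: it is equivalent to (ω, φ)
    ∃ ϕ : ℕ → g →ₗ[K] g, ϕ 0 = LinearMap.id ∧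
      (∀ (n : ℕ) (x y : g),
        ∑ i ∈ Finset.range (n + 1), ϕ i (ω (n - i) x y) =
          ∑ i ∈ Finset.range (n + 1), ⁅ϕ i x, ϕ (n - i) y⁆) ∧
      (∀ (n : ℕ) (x : g),
        ∑ i ∈ Finset.range (n + 1), ϕ i (φd (n - i) x) = φ (ϕ n x)) := by
  have hJ : ∀ (n : ℕ) (x y z : g), ∑ p ∈ Finset.HasAntidiagonal.antidiagonal n,
      (ω p.1 (ω p.2 x y) z + ω p.1 (ω p.2 y z) x + ω p.1 (ω p.2 z x) y) = 0 := fun n x y z =>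
    (Finset.Nat.sum_antidiagonal_eq_sum_range_succ
      (fun i j => ω i (ω j x y) z + ω i (ω j y z) x + ω i (ω j z x) y) n).trans (hdef1 n x y z)
  have hder : ∀ (n : ℕ) (x y : g), ∑ p ∈ Finset.HasAntidiagonal.antidiagonal n,
      (φd p.1 (ω p.2 x y) - ω p.2 (φd p.1 x) y - ω p.2 x (φd p.1 y)) = 0 := fun n x y =>
    (Finset.Nat.sum_antidiagonal_eq_sum_range_succ
      (fun i j => φd i (ω j x y) - ω j (φd i x) y - ω j x (φd i y)) n).trans (hdef2 n x y)
  obtain ⟨ϕ, hϕ0, hD, hE⟩ :=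
    LieDerDeformation.exists_trivialization hφ hH2 hω0 hφ0 hskew hJ hder
  refine ⟨ϕ, hϕ0, fun n x y => ?_, fun n x => ?_⟩
  · have h := LieDerDeformation.bracketDefect_apply ω ϕ n x y
    rw [hD, LinearMap.zero_apply, LinearMap.zero_apply, eq_comm, sub_eq_zero] at h
    rw [← Nat.succ_eq_add_one,
      ← Finset.Nat.sum_antidiagonal_eq_sum_range_succ (fun i j => ϕ i (ω j x y)), h,
      ← Finset.Nat.sum_antidiagonal_eq_sum_range_succ (fun i j => ⁅ϕ i x, ϕ j y⁆)]
  · have h := LieDerDeformation.derivationDefect_apply φ φd ϕ n x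
    rw [hE, LinearMap.zero_apply, eq_comm, sub_eq_zero] at h
    rw [← h]
    exact (Finset.Nat.sum_antidiagonal_eq_sum_range_succ (fun i j => ϕ i (φd j x)) n).symm
end

section
/- Let (g, φ) be a LieDer pair over a field K of characteristic 0 with bracket ω, and let (ω_i, φ_i)_{0 ≤ i ≤ n} be a deformation of order n of (g, φ), i.e. ω_0 = ω, φ_0 = φ and for every 0 ≤ m ≤ n and all x,y,z ∈ g: Σ_{i+j=m, 0≤i,j≤n} (ω_i(ω_j(x,y),z) + ω_i(ω_j(y,z),x) + ω_i(ω_j(z,x),y)) = 0 and Σ_{i+j=m, 0≤i,j≤n} (φ_i(ω_j(x,y)) − ω_j(φ_i(x),y) − ω_j(x,φ_i(y))) = 0. Define Ob³(x,y,z) = Σ_{i+j=n+1, i,j≥1} (ω_i(ω_j(x,y),z) + ω_i(ω_j(y,z),x) + ω_i(ω_j(z,x),y)) and Ob²(x,y) = Σ_{i+j=n+1, i,j≥1} (φ_i(ω_j(x,y)) − ω_j(φ_i(x),y) − ω_j(x,φ_i(y))). Then (Ob³, Ob²) is a 3-cocycle of the LieDer pair (g, φ) with adjoint coefficients: d Ob³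 = 0 and d Ob² − δ Ob³ = 0. -/
open Finset in
/-- The sum of `f a b c` over all `a + b + c = N`. -/
def tripleSum {M : Type*} [AddCommMonoid M] (N : ℕ) (f : ℕ → ℕ → ℕ → M) : M :=
  ∑ p ∈ antidiagonal N, ∑ q ∈ antidiagonal p.2, f p.1 q.1 q.2

open Finset in
theorem tripleSum_swap_right {M : Type*} [AddCommMonoid M] (N : ℕ) (f : ℕ → ℕ → ℕ → M) :
    tripleSum N (fun a b c => f a c b) = tripleSum N f :=
  sum_congr rfl fun p _ => Nat.sum_antidiagonal_swap (n := p.2) (f := fun q => f p.1 q.1 q.2)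

open Finset in
theorem tripleSum_rotate {M : Type*} [AddCommMonoid M] (N : ℕ) (f : ℕ → ℕ → ℕ → M) :
    tripleSum N (fun a b c => f b c a) = tripleSum N f := by
  unfold tripleSum
  rw [sum_sigma', sum_sigma']
  refine sum_bij' (fun s _ => ⟨(s.2.1, s.2.2 + s.1.1), (s.2.2, s.1.1)⟩)
    (fun s _ => ⟨(s.2.2, s.1.1 + s.2.1), (s.1.1, s.2.1)⟩) ?_ ?_ ?_ ?_ ?_ <;>
  · rintro ⟨⟨a, m⟩, ⟨b, c⟩⟩ hs
    simp only [mem_sigma, HasAntidiagonal.mem_antidiagonal] at hs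
    grind [HasAntidiagonal.mem_antidiagonal]

theorem tripleSum_swap_left {M : Type*} [AddCommMonoid M] (N : ℕ) (f : ℕ → ℕ → ℕ → M) :
    tripleSum N (fun a b c => f b a c) = tripleSum N f :=
  (tripleSum_rotate N fun a b c => f a c b).trans (tripleSum_swap_right N f)

section FormalSeries

variable {K g : Type*} [Field K] [AddCommGroup g] [Module K g]

open Finset in
/-- The coefficient of `t ^ m` in the Jacobiator of `∑ ωᵢ tⁱ`. -/
def jacobiatorCoeff (ω : ℕ → g →ₗ[K] g →ₗ[K] g) (m : ℕ) (x y z : g) : g :=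
  ∑ q ∈ antidiagonal m,
    (ω q.1 (ω q.2 x y) z + ω q.1 (ω q.2 y z) x + ω q.1 (ω q.2 z x) y)

open Finset in
/-- The coefficient of `t ^ m` in the failure of `∑ φᵢ tⁱ` to be a derivation of `∑ ωᵢ tⁱ`. -/
def derivationDefectCoeff (ω : ℕ → g →ₗ[K] g →ₗ[K] g) (φ : ℕ → g →ₗ[K] g) (m : ℕ) (x y : g) : g :=
  ∑ q ∈ antidiagonal m,
    (φ q.1 (ω q.2 x y) - ω q.2 (φ q.1 x) y - ω q.2 x (φ q.1 y))

variable (ω : ℕ → g →ₗ[K] g →ₗ[K] g) (φ : ℕ → g →ₗ[K] g)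

open Finset in
theorem sum_apply_jacobiatorCoeff (N : ℕ) (x y z w : g) :
    ∑ p ∈ antidiagonal N, ω p.1 x (jacobiatorCoeff ω p.2 y z w) =
      tripleSum N fun a b c =>
        ω a x (ω b (ω c y z) w) + ω a x (ω b (ω c z w) y) + ω a x (ω b (ω c w y) z) := by
  simp only [jacobiatorCoeff, tripleSum, map_sum, map_add]

open Finset in
theorem sum_jacobiatorCoeff_apply (N : ℕ) (x y z w : g) :
    ∑ p ∈ antidiagonal N, jacobiatorCoeff ω p.2 (ω p.1 x y) z w =
      tripleSum N fun a b c =>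
        ω a (ω b (ω c x y) z) w + ω a (ω b z w) (ω c x y) + ω a (ω b w (ω c x y)) z :=
  tripleSum_rotate N fun a b c =>
    ω a (ω b (ω c x y) z) w + ω a (ω b z w) (ω c x y) + ω a (ω b w (ω c x y)) z

open Finset in
/-- The Bianchi identity for the Jacobiator of a formal series of skew brackets. -/
theorem sum_coboundary_jacobiatorCoeff (hskew : ∀ i x y, ω i x y = -ω i y x)
    (N : ℕ) (x y z w : g) :
    ∑ p ∈ antidiagonal N,
      (ω p.1 x (jacobiatorCoeff ω p.2 y z w) - ω p.1 y (jacobiatorCoeff ω p.2 x z w)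
        + ω p.1 z (jacobiatorCoeff ω p.2 x y w) - ω p.1 w (jacobiatorCoeff ω p.2 x y z)
        - jacobiatorCoeff ω p.2 (ω p.1 x y) z w + jacobiatorCoeff ω p.2 (ω p.1 x z) y w
        - jacobiatorCoeff ω p.2 (ω p.1 x w) y z - jacobiatorCoeff ω p.2 (ω p.1 y z) x w
        + jacobiatorCoeff ω p.2 (ω p.1 y w) x z - jacobiatorCoeff ω p.2 (ω p.1 z w) x y) = 0 := by
  have hcross (x y z w : g) :
      tripleSum N (fun a b c => ω a (ω b z w) (ω c x y) + ω a (ω b x y) (ω c z w)) = 0 := by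
    have h := tripleSum_swap_right N fun a b c => ω a (ω b x y) (ω c z w)
    simp only [tripleSum, sum_add_distrib] at h ⊢
    rw [← h, ← sum_add_distrib]
    refine sum_eq_zero fun p _ => ?_
    rw [← sum_add_distrib]
    refine sum_eq_zero fun q _ => ?_
    rw [hskew p.1 (ω q.1 z w), neg_add_cancel]
  have h₁ := hcross x y z w
  have h₂ := hcross x z y w
  have h₃ := hcross x w y z
  simp only [sum_add_distrib, sum_sub_distrib, sum_apply_jacobiatorCoeff,
    sum_jacobiatorCoeff_apply]
  have key := congrArg₂ (· - ·) (congrArg₂ (· - ·) h₂ h₁) h₃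
  refine Eq.trans ?_ (key.trans (by simp))
  simp only [tripleSum, ← sum_add_distrib, ← sum_sub_distrib]
  refine sum_congr rfl fun p _ => sum_congr rfl fun q _ => ?_
  generalize p.1 = a
  generalize q.1 = b
  generalize q.2 = c
  simp only [hskew a x, hskew a y, hskew a z, hskew a w, hskew b y (ω c _ _),
    hskew b z (ω c _ _), hskew b w (ω c _ _), hskew c z x, hskew c w x, hskew c w y,
    map_neg, LinearMap.neg_apply]
  abel

open Finset in
/-- The Jacobiator and the derivation defect are compatible. -/
theorem sum_derivation_jacobiatorCoeff (N : ℕ) (x y z : g) :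
    ∑ p ∈ antidiagonal N,
      (φ p.1 (jacobiatorCoeff ω p.2 x y z) - jacobiatorCoeff ω p.2 (φ p.1 x) y z
        - jacobiatorCoeff ω p.2 x (φ p.1 y) z - jacobiatorCoeff ω p.2 x y (φ p.1 z)) =
    ∑ p ∈ antidiagonal N,
      (derivationDefectCoeff ω φ p.2 (ω p.1 x y) z + derivationDefectCoeff ω φ p.2 (ω p.1 y z) x
        + derivationDefectCoeff ω φ p.2 (ω p.1 z x) y
        + (ω p.1 (derivationDefectCoeff ω φ p.2 x y) z
          + ω p.1 (derivationDefectCoeff ω φ p.2 y z) x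
          + ω p.1 (derivationDefectCoeff ω φ p.2 z x) y)) := by
  have hinner (x y z : g) :
      ∑ p ∈ antidiagonal N, derivationDefectCoeff ω φ p.2 (ω p.1 x y) z =
        tripleSum N fun a b c =>
          φ a (ω b (ω c x y) z) - ω b (φ a (ω c x y)) z - ω b (ω c x y) (φ a z) :=
    tripleSum_rotate N fun a b c =>
      φ a (ω b (ω c x y) z) - ω b (φ a (ω c x y)) z - ω b (ω c x y) (φ a z)
  have houter (x y z : g) :
      ∑ p ∈ antidiagonal N, ω p.1 (derivationDefectCoeff ω φ p.2 x y) z =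
        tripleSum N fun a b c =>
          ω b (φ a (ω c x y)) z - ω b (ω c (φ a x) y) z - ω b (ω c x (φ a y)) z := by
    rw [← tripleSum_swap_left]
    simp only [derivationDefectCoeff, tripleSum, map_sum, map_sub, LinearMap.sum_apply,
      LinearMap.sub_apply]
  simp only [sum_add_distrib (s := antidiagonal N), hinner, houter]
  simp only [jacobiatorCoeff, tripleSum, map_sum, map_add, ← sum_add_distrib, ← sum_sub_distrib]
  refine sum_congr rfl fun p _ => sum_congr rfl fun q _ => ?_
  abel

end FormalSeries

open Finset in
theorem sum_antidiagonal_eq_of_snd_lt {M : Type*} [AddCommMonoid M] (N : ℕ) (f : ℕ × ℕ → M)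
    (h : ∀ p, p.2 < N → f p = 0) : ∑ p ∈ antidiagonal N, f p = f (0, N) :=
  sum_eq_single_of_mem (0, N) (by simp) fun p hp hne => h p <| by
    rw [HasAntidiagonal.mem_antidiagonal] at hp
    have : p.1 ≠ 0 := fun h0 => hne (Prod.ext h0 (by simp; omega))
    omega

open Finset in
theorem sum_antidiagonal_succ_eq_sum_Icc {M : Type*} [AddCommMonoid M] (n : ℕ) (f : ℕ → ℕ → M)
    (h₀ : f 0 (n + 1) = 0) (h₁ : f (n + 1) 0 = 0) :
    ∑ q ∈ antidiagonal (n + 1), f q.1 q.2 = ∑ i ∈ Icc 1 n, f i (n + 1 - i) := by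
  rw [Nat.sum_antidiagonal_eq_sum_range_succ f, sum_range_succ, Nat.sub_self, h₁, add_zero,
    sum_range_succ', Nat.sub_zero, h₀, add_zero, range_eq_Ico,
    sum_Ico_add' (fun i => f i (n + 1 - i)) 0 n 1]
  rfl

/-- Let `(g, φ)` be a LieDer pair over a field `K` of characteristic `0`
and `(ωᵢ, φᵢ)_{0≤i≤n}` a deformation of order `n` of `(g, φ)`.  Then the obstruction
`(Ob³, Ob²)`, with `Ob³(x,y,z) = Σ_{i+j=n+1, i,j≥1} (ωᵢ(ωⱼ(x,y),z) + c.p.)` and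
`Ob²(x,y) = Σ_{i+j=n+1, i,j≥1} (φᵢ(ωⱼ(x,y)) − ωⱼ(φᵢx,y) − ωⱼ(x,φᵢy))`, is a
3-cocycle of the LieDer pair with adjoint coefficients: `d Ob³ = 0` and
`d Ob² − δ Ob³ = 0`. -/
theorem obstruction_is_cocycle {K g : Type*} [Field K] [CharZero K]
    [LieRing g] [LieAlgebra K g]
    (φ : g →ₗ[K] g) (hφ : ∀ x y : g, φ ⁅x, y⁆ = ⁅φ x, y⁆ + ⁅x, φ y⁆)
    (n : ℕ)
    (ω : ℕ → g →ₗ[K] g →ₗ[K] g) (φd : ℕ → g →ₗ[K] g)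
    (hω0 : ∀ x y : g, ω 0 x y = ⁅x, y⁆) (hφ0 : φd 0 = φ)
    (hskew : ∀ (i : ℕ) (x y : g), ω i x y = - ω i y x)
    (hdef1 : ∀ m ≤ n, ∀ x y z : g,
      ∑ i ∈ Finset.range (m + 1),
        (ω i (ω (m - i) x y) z + ω i (ω (m - i) y z) x + ω i (ω (m - i) z x) y) = 0)
    (hdef2 : ∀ m ≤ n, ∀ x y : g,
      ∑ i ∈ Finset.range (m + 1),
        (φd i (ω (m - i) x y) - ω (m - i) (φd i x) y - ω (m - i) x (φd i y)) = 0)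
    (Ob3 : g → g → g → g)
    (hOb3 : ∀ x y z : g, Ob3 x y z =
      ∑ i ∈ Finset.Icc 1 n,
        (ω i (ω (n + 1 - i) x y) z + ω i (ω (n + 1 - i) y z) x
          + ω i (ω (n + 1 - i) z x) y))
    (Ob2 : g → g → g)
    (hOb2 : ∀ x y : g, Ob2 x y =
      ∑ i ∈ Finset.Icc 1 n,
        (φd i (ω (n + 1 - i) x y) - ω (n + 1 - i) (φd i x) y
          - ω (n + 1 - i) x (φd i y))) :
    -- d Ob³ = 0
    (∀ x y z w : g,
      ⁅x, Ob3 y z w⁆ - ⁅y, Ob3 x z w⁆ + ⁅z, Ob3 x y w⁆ - ⁅w, Ob3 x y z⁆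
        - Ob3 ⁅x, y⁆ z w + Ob3 ⁅x, z⁆ y w - Ob3 ⁅x, w⁆ y z
        - Ob3 ⁅y, z⁆ x w + Ob3 ⁅y, w⁆ x z - Ob3 ⁅z, w⁆ x y = 0) ∧
    -- d Ob² − δ Ob³ = 0
    (∀ x y z : g,
      (⁅x, Ob2 y z⁆ - ⁅y, Ob2 x z⁆ + ⁅z, Ob2 x y⁆
        - Ob2 ⁅x, y⁆ z + Ob2 ⁅x, z⁆ y - Ob2 ⁅y, z⁆ x)
        - (Ob3 (φ x) y z + Ob3 x (φ y) z + Ob3 x y (φ z) - φ (Ob3 x y z)) = 0) := by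
  set W : ℕ → g →ₗ[K] g →ₗ[K] g := fun i => if i ≤ n then ω i else 0 with hW
  set D : ℕ → g →ₗ[K] g := fun i => if i ≤ n then φd i else 0 with hD
  have hWle {i : ℕ} (hi : i ≤ n) : W i = ω i := if_pos hi
  have hDle {i : ℕ} (hi : i ≤ n) : D i = φd i := if_pos hi
  have hWtop : W (n + 1) = 0 := if_neg (by omega)
  have hDtop : D (n + 1) = 0 := if_neg (by omega)
  have hW0 (x y : g) : W 0 x y = ⁅x, y⁆ := by rw [hWle (Nat.zero_le n), hω0]
  have hD0 : D 0 = φ := by rw [hDle (Nat.zero_le n), hφ0]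
  have hWskew (i : ℕ) (x y : g) : W i x y = -W i y x := by
    by_cases hi : i ≤ n
    · rw [hWle hi, hskew]
    · simp [hW, hi]
  have hJ (m : ℕ) (hm : m < n + 1) (x y z : g) : jacobiatorCoeff W m x y z = 0 := by
    rw [← hdef1 m (by omega) x y z, jacobiatorCoeff, Finset.Nat.sum_antidiagonal_eq_sum_range_succ
      (fun i j => W i (W j x y) z + W i (W j y z) x + W i (W j z x) y)]
    refine Finset.sum_congr rfl fun i hi => ?_
    rw [Finset.mem_range] at hi
    rw [hWle (by omega : i ≤ n), hWle (by omega : m - i ≤ n)]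
  have hE (m : ℕ) (hm : m < n + 1) (x y : g) : derivationDefectCoeff W D m x y = 0 := by
    rw [← hdef2 m (by omega) x y, derivationDefectCoeff,
      Finset.Nat.sum_antidiagonal_eq_sum_range_succ
      (fun i j => D i (W j x y) - W j (D i x) y - W j x (D i y))]
    refine Finset.sum_congr rfl fun i hi => ?_
    rw [Finset.mem_range] at hi
    rw [hDle (by omega : i ≤ n), hWle (by omega : m - i ≤ n)]
  have hJtop (x y z : g) : jacobiatorCoeff W (n + 1) x y z = Ob3 x y z := by
    rw [hOb3, jacobiatorCoeff, sum_antidiagonal_succ_eq_sum_Icc n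
      (fun i j => W i (W j x y) z + W i (W j y z) x + W i (W j z x) y)
      (by simp [hWtop]) (by simp [hWtop])]
    refine Finset.sum_congr rfl fun i hi => ?_
    rw [Finset.mem_Icc] at hi
    rw [hWle hi.2, hWle (by omega : n + 1 - i ≤ n)]
  have hEtop (x y : g) : derivationDefectCoeff W D (n + 1) x y = Ob2 x y := by
    rw [hOb2, derivationDefectCoeff, sum_antidiagonal_succ_eq_sum_Icc n
      (fun i j => D i (W j x y) - W j (D i x) y - W j x (D i y))
      (by simp [hWtop]) (by simp [hDtop])]
    refine Finset.sum_congr rfl fun i hi => ?_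
    rw [Finset.mem_Icc] at hi
    rw [hDle hi.2, hWle (by omega : n + 1 - i ≤ n)]
  refine ⟨fun x y z w => ?_, fun x y z => ?_⟩
  · have h := sum_coboundary_jacobiatorCoeff W hWskew (n + 1) x y z w
    rw [sum_antidiagonal_eq_of_snd_lt _ _ fun p hp => by simp [hJ p.2 hp]] at h
    simpa only [hJtop, hW0] using h
  · have h := sum_derivation_jacobiatorCoeff W D (n + 1) x y z
    rw [sum_antidiagonal_eq_of_snd_lt _ _ fun p hp => by simp [hJ p.2 hp],
      sum_antidiagonal_eq_of_snd_lt _ _ fun p hp => by simp [hE p.2 hp]] at h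
    simp only [hJtop, hEtop, hW0, hD0] at h
    have hOb2neg (u v : g) : Ob2 (-u) v = -Ob2 u v := by
      rw [hOb2, hOb2, ← Finset.sum_neg_distrib]
      refine Finset.sum_congr rfl fun i _ => ?_
      simp only [map_neg, LinearMap.neg_apply]
      abel
    have hOb2skew (u v : g) : Ob2 u v = -Ob2 v u := by
      rw [hOb2, hOb2, ← Finset.sum_neg_distrib]
      refine Finset.sum_congr rfl fun i _ => ?_
      rw [hskew _ u v, hskew _ (φd i u) v, hskew _ u (φd i v), map_neg]
      abel
    rw [← lie_skew z x, hOb2neg, hOb2skew z x, ← lie_skew (Ob2 x y) z,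
      ← lie_skew (Ob2 y z) x, ← lie_skew (-Ob2 x z) y, lie_neg] at h
    rw [← sub_eq_zero] at h
    refine Eq.trans ?_ h
    abel
end

section
/- Let (g, φ) be a LieDer pair over a field K of characteristic 0 and let (ω_i, φ_i)_{0 ≤ i ≤ n} be a deformation of order n of (g, φ), with obstruction 3-cochain (Ob³, Ob²) given by Ob³(x,y,z) = Σ_{i+j=n+1, i,j≥1} (ω_i(ω_j(x,y),z) + ω_i(ω_j(y,z),x) + ω_i(ω_j(z,x),y)) and Ob²(x,y) = Σ_{i+j=n+1, i,j≥1} (φ_i(ω_j(x,y)) − ω_j(φ_i(x),y) − ω_j(x,φ_i(y))). Then the deformation is extensible — i.e. there exist a skew-symmetric bilinear map ω_{n+1} : g × g → g and a linear map φ_{n+1} : g → g such that (ω_i, φ_i)_{0 ≤ i ≤ n+1} is a deformation of order n+1 — if and only if (Ob³, Ob²) is a coboundary, i.e. there exists a 2-cochain (ω', φ') ∈ C^2(g;g) × C^1(g;g) with Ob³ = d ω' and Ob² = d φ' + δ ω'. -/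
theorem sum_range_add_two_eq_ends_add_Icc {M : Type*} [AddCommMonoid M] (f : ℕ → M) (n : ℕ) :
    ∑ i ∈ Finset.range (n + 2), f i = f 0 + f (n + 1) + ∑ i ∈ Finset.Icc 1 n, f i := by
  have h : ∑ i ∈ Finset.Icc 1 n, f i = ∑ i ∈ Finset.range n, f (i + 1) := by
    rw [← Finset.Ico_add_one_right_eq_Icc, Finset.sum_Ico_eq_sum_range]
    simp [add_comm]
  rw [Finset.sum_range_succ, Finset.sum_range_succ', h]
  abel

/-- The Jacobi identity in top degree says that the intermediate terms form the
Chevalley–Eilenberg coboundary of the top bilinear map. -/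
theorem sum_jacobiator_eq_zero_iff {K g : Type*} [Field K] [LieRing g] [LieAlgebra K g]
    (n : ℕ) (ω : ℕ → g →ₗ[K] g →ₗ[K] g) (hω0 : ∀ x y : g, ω 0 x y = ⁅x, y⁆)
    (hskew : ∀ x y : g, ω (n + 1) x y = - ω (n + 1) y x) (x y z : g) :
    ∑ i ∈ Finset.range (n + 1 + 1),
        (ω i (ω (n + 1 - i) x y) z + ω i (ω (n + 1 - i) y z) x
          + ω i (ω (n + 1 - i) z x) y) = 0 ↔
      ∑ i ∈ Finset.Icc 1 n,
        (ω i (ω (n + 1 - i) x y) z + ω i (ω (n + 1 - i) y z) x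
          + ω i (ω (n + 1 - i) z x) y) =
        ⁅x, ω (n + 1) y z⁆ - ⁅y, ω (n + 1) x z⁆ + ⁅z, ω (n + 1) x y⁆
          - ω (n + 1) ⁅x, y⁆ z + ω (n + 1) ⁅x, z⁆ y - ω (n + 1) ⁅y, z⁆ x := by
  rw [sum_range_add_two_eq_ends_add_Icc, add_comm, add_eq_zero_iff_eq_neg]
  simp only [Nat.sub_zero, Nat.sub_self, hω0]
  rw [hskew x z, lie_neg, ← lie_skew x (ω (n + 1) y z), ← lie_skew y (ω (n + 1) z x),
    ← lie_skew z (ω (n + 1) x y), ← lie_skew x z]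
  simp only [map_neg, LinearMap.neg_apply]
  refine iff_of_eq (congrArg _ ?_)
  abel

/-- The derivation identity in top degree says that the intermediate terms are
`d` of the top linear map plus `δ` of the top bilinear map. -/
theorem sum_derivation_defect_eq_zero_iff {K g : Type*} [Field K] [LieRing g] [LieAlgebra K g]
    (n : ℕ) (ω : ℕ → g →ₗ[K] g →ₗ[K] g) (φ : ℕ → g →ₗ[K] g)
    (hω0 : ∀ x y : g, ω 0 x y = ⁅x, y⁆) (x y : g) :
    ∑ i ∈ Finset.range (n + 1 + 1),
        (φ i (ω (n + 1 - i) x y) - ω (n + 1 - i) (φ i x) y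
          - ω (n + 1 - i) x (φ i y)) = 0 ↔
      ∑ i ∈ Finset.Icc 1 n,
        (φ i (ω (n + 1 - i) x y) - ω (n + 1 - i) (φ i x) y
          - ω (n + 1 - i) x (φ i y)) =
        (⁅x, φ (n + 1) y⁆ - ⁅y, φ (n + 1) x⁆ - φ (n + 1) ⁅x, y⁆)
          + (ω (n + 1) (φ 0 x) y + ω (n + 1) x (φ 0 y) - φ 0 (ω (n + 1) x y)) := by
  rw [sum_range_add_two_eq_ends_add_Icc, add_comm, add_eq_zero_iff_eq_neg]
  simp only [Nat.sub_zero, Nat.sub_self, hω0]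
  rw [← lie_skew y]
  refine iff_of_eq (congrArg _ ?_)
  abel

/-- The terms of the two deformation equations in a degree `m`, summed over indices `i` such
that `i` and `m - i` are at most `n`, only depend on the maps of index at most `n`. -/
theorem sum_deformation_terms_congr {K g : Type*} [Field K] [LieRing g] [LieAlgebra K g]
    {n m : ℕ} {ω ω' : ℕ → g →ₗ[K] g →ₗ[K] g} {φ φ' : ℕ → g →ₗ[K] g}
    (hω : ∀ i ≤ n, ω i = ω' i) (hφ : ∀ i ≤ n, φ i = φ' i) {s : Finset ℕ}
    (hs : ∀ i ∈ s, i ≤ n ∧ m - i ≤ n) (x y z : g) :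
    ∑ i ∈ s, (ω i (ω (m - i) x y) z + ω i (ω (m - i) y z) x + ω i (ω (m - i) z x) y) =
      ∑ i ∈ s, (ω' i (ω' (m - i) x y) z + ω' i (ω' (m - i) y z) x
        + ω' i (ω' (m - i) z x) y) ∧
    ∑ i ∈ s, (φ i (ω (m - i) x y) - ω (m - i) (φ i x) y - ω (m - i) x (φ i y)) =
      ∑ i ∈ s, (φ' i (ω' (m - i) x y) - ω' (m - i) (φ' i x) y
        - ω' (m - i) x (φ' i y)) := by
  constructor <;> refine Finset.sum_congr rfl fun i hi => ?_
  · rw [hω i (hs i hi).1, hω _ (hs i hi).2]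
  · rw [hφ i (hs i hi).1, hω _ (hs i hi).2]

/-- Let `(g, φ)` be a LieDer pair over a field `K` of characteristic `0`
and `(ωᵢ, φᵢ)_{0≤i≤n}` a deformation of order `n` of `(g, φ)`, with obstruction
3-cochain `(Ob³, Ob²)`.  The deformation is extensible (there exist a skew-symmetric
bilinear `ω_{n+1}` and a linear `φ_{n+1}` making `(ωᵢ, φᵢ)_{0≤i≤n+1}` a deformation of
order `n + 1`) if and only if `(Ob³, Ob²)` is a coboundary: there exists a 2-cochain
`(ω', φ')` with `Ob³ = d ω'` and `Ob² = d φ' + δ ω'`. -/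
theorem extensible_iff_obstruction_coboundary {K g : Type*} [Field K] [CharZero K]
    [LieRing g] [LieAlgebra K g]
    (φ : g →ₗ[K] g) (hφ : ∀ x y : g, φ ⁅x, y⁆ = ⁅φ x, y⁆ + ⁅x, φ y⁆)
    (n : ℕ)
    (ω : ℕ → g →ₗ[K] g →ₗ[K] g) (φd : ℕ → g →ₗ[K] g)
    (hω0 : ∀ x y : g, ω 0 x y = ⁅x, y⁆) (hφ0 : φd 0 = φ)
    (hskew : ∀ (i : ℕ) (x y : g), ω i x y = - ω i y x)
    (hdef1 : ∀ m ≤ n, ∀ x y z : g,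
      ∑ i ∈ Finset.range (m + 1),
        (ω i (ω (m - i) x y) z + ω i (ω (m - i) y z) x + ω i (ω (m - i) z x) y) = 0)
    (hdef2 : ∀ m ≤ n, ∀ x y : g,
      ∑ i ∈ Finset.range (m + 1),
        (φd i (ω (m - i) x y) - ω (m - i) (φd i x) y - ω (m - i) x (φd i y)) = 0)
    (Ob3 : g → g → g → g)
    (hOb3 : ∀ x y z : g, Ob3 x y z =
      ∑ i ∈ Finset.Icc 1 n,
        (ω i (ω (n + 1 - i) x y) z + ω i (ω (n + 1 - i) y z) x
          + ω i (ω (n + 1 - i) z x) y))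
    (Ob2 : g → g → g)
    (hOb2 : ∀ x y : g, Ob2 x y =
      ∑ i ∈ Finset.Icc 1 n,
        (φd i (ω (n + 1 - i) x y) - ω (n + 1 - i) (φd i x) y
          - ω (n + 1 - i) x (φd i y))) :
    -- the deformation is extensible to a deformation of order n + 1
    (∃ (ωe : ℕ → g →ₗ[K] g →ₗ[K] g) (φe : ℕ → g →ₗ[K] g),
      (∀ i ≤ n, ωe i = ω i) ∧ (∀ i ≤ n, φe i = φd i) ∧
      (∀ x y : g, ωe (n + 1) x y = - ωe (n + 1) y x) ∧
      (∀ m ≤ n + 1, ∀ x y z : g,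
        ∑ i ∈ Finset.range (m + 1),
          (ωe i (ωe (m - i) x y) z + ωe i (ωe (m - i) y z) x
            + ωe i (ωe (m - i) z x) y) = 0) ∧
      (∀ m ≤ n + 1, ∀ x y : g,
        ∑ i ∈ Finset.range (m + 1),
          (φe i (ωe (m - i) x y) - ωe (m - i) (φe i x) y
            - ωe (m - i) x (φe i y)) = 0))
    ↔
    -- the obstruction class is trivial: (Ob³, Ob²) = ∂(ω', φ') = (d ω', d φ' + δ ω')
    (∃ (ω' : g →ₗ[K] g →ₗ[K] g) (φ' : g →ₗ[K] g),
      (∀ x y : g, ω' x y = - ω' y x) ∧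
      (∀ x y z : g, Ob3 x y z =
        ⁅x, ω' y z⁆ - ⁅y, ω' x z⁆ + ⁅z, ω' x y⁆
          - ω' ⁅x, y⁆ z + ω' ⁅x, z⁆ y - ω' ⁅y, z⁆ x) ∧
      (∀ x y : g, Ob2 x y =
        (⁅x, φ' y⁆ - ⁅y, φ' x⁆ - φ' ⁅x, y⁆)
          + (ω' (φ x) y + ω' x (φ y) - φ (ω' x y)))) := by
  have hIcc : ∀ i ∈ Finset.Icc 1 n, i ≤ n ∧ n + 1 - i ≤ n := by
    intro i hi
    rw [Finset.mem_Icc] at hi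
    omega
  constructor
  · rintro ⟨ωe, φe, hω, hφe, hsk, h1, h2⟩
    have hωe0 : ∀ x y : g, ωe 0 x y = ⁅x, y⁆ := by
      simpa [hω 0 n.zero_le] using hω0
    refine ⟨ωe (n + 1), φe (n + 1), hsk, fun x y z => ?_, fun x y => ?_⟩
    · rw [hOb3, ← (sum_deformation_terms_congr hω hφe hIcc x y z).1]
      exact (sum_jacobiator_eq_zero_iff n ωe hωe0 hsk x y z).1 (h1 _ le_rfl x y z)
    · rw [hOb2, ← (sum_deformation_terms_congr hω hφe hIcc x y 0).2, ← hφ0, ← hφe 0 n.zero_le]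
      exact (sum_derivation_defect_eq_zero_iff n ωe φe hωe0 x y).1 (h2 _ le_rfl x y)
  · rintro ⟨ω', φ', hsk, h1, h2⟩
    obtain ⟨ωe, hω, rfl⟩ : ∃ ωe : ℕ → g →ₗ[K] g →ₗ[K] g,
        (∀ i ≤ n, ωe i = ω i) ∧ ωe (n + 1) = ω' :=
      ⟨Function.update ω (n + 1) ω',
        fun i hi => Function.update_of_ne (by omega) _ _, Function.update_self _ _ _⟩
    obtain ⟨φe, hφe, rfl⟩ : ∃ φe : ℕ → g →ₗ[K] g,
        (∀ i ≤ n, φe i = φd i) ∧ φe (n + 1) = φ' :=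
      ⟨Function.update φd (n + 1) φ',
        fun i hi => Function.update_of_ne (by omega) _ _, Function.update_self _ _ _⟩
    have hωe0 : ∀ x y : g, ωe 0 x y = ⁅x, y⁆ := by
      simpa [hω 0 n.zero_le] using hω0
    have hrange : ∀ m ≤ n, ∀ i ∈ Finset.range (m + 1), i ≤ n ∧ m - i ≤ n := by
      intro m hm i hi
      rw [Finset.mem_range] at hi
      omega
    refine ⟨ωe, φe, hω, hφe, hsk, fun m hm x y z => ?_, fun m hm x y => ?_⟩
    · rcases Nat.le_succ_iff.1 hm with hm | rfl
      · rw [(sum_deformation_terms_congr hω hφe (hrange m hm) x y z).1]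
        exact hdef1 m hm x y z
      · refine (sum_jacobiator_eq_zero_iff n ωe hωe0 hsk x y z).2 ?_
        rw [(sum_deformation_terms_congr hω hφe hIcc x y z).1, ← hOb3]
        exact h1 x y z
    · rcases Nat.le_succ_iff.1 hm with hm | rfl
      · rw [(sum_deformation_terms_congr hω hφe (hrange m hm) x y 0).2]
        exact hdef2 m hm x y
      · refine (sum_derivation_defect_eq_zero_iff n ωe φe hωe0 x y).2 ?_
        rw [(sum_deformation_terms_congr hω hφe hIcc x y 0).2, ← hOb2, hφe 0 n.zero_le, hφ0]
        exact h2 x y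
end

section
/- Let (g, φ_g) be a LieDer pair over a field K of characteristic 0, let h be a vector space with a linear endomorphism φ_h (an abelian LieDer pair), and let ψ : g × g → h be a skew-symmetric bilinear map and χ : g → h a linear map. Define on g ⊕ h the bracket [x+u, y+v]_ψ = [x,y]_g + ψ(x,y) and the linear map φ_χ(x+u) = φ_g(x) + χ(x) + φ_h(u), for x,y ∈ g, u,v ∈ h. Then (g ⊕ h, φ_χ) is a LieDer pair (i.e. [·,·]_ψ satisfies the Jacobi identity and φ_χ is a derivation of it) if and only if for all x,y,z ∈ g: ψ([x,y]_g, z) + ψ([y,z]_g, x) + ψ([z,x]_g, y) = 0 and χ([x,y]_g) + φ_h(ψ(x,y)) − ψ(φ_g(x), y) − ψ(x, φ_g(y)) = 0. -/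
/-- Let `(g, φg)` be a LieDer pair over a field `K` of characteristic `0`,
`(h, φh)` an abelian LieDer pair (a vector space with a linear endomorphism), `ψ` a
skew-symmetric bilinear map `g × g → h` and `χ : g → h` linear.  Equip `g ⊕ h` with
`[x+u, y+v]_ψ = [x,y]_g + ψ(x,y)` and `φ_χ(x+u) = φg(x) + χ(x) + φh(u)`.  Then
`(g ⊕ h, φ_χ)` is a LieDer pair (Jacobi identity for `[·,·]_ψ` and `φ_χ` a derivation)
iff `(ψ, χ)` is a 2-cocycle with trivial coefficients:
`ψ([x,y],z) + ψ([y,z],x) + ψ([z,x],y) = 0` and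
`χ([x,y]) + φh(ψ(x,y)) − ψ(φg x, y) − ψ(x, φg y) = 0`. -/
theorem central_extension_lieDer_iff_cocycle {K g h : Type*} [Field K] [CharZero K]
    [LieRing g] [LieAlgebra K g] [AddCommGroup h] [Module K h]
    (φg : g →ₗ[K] g) (hφg : ∀ x y : g, φg ⁅x, y⁆ = ⁅φg x, y⁆ + ⁅x, φg y⁆)
    (φh : h →ₗ[K] h)
    (ψ : g →ₗ[K] g →ₗ[K] h) (hψ : ∀ x y : g, ψ x y = - ψ y x)
    (χ : g →ₗ[K] h)
    (Br : g × h → g × h → g × h)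
    (hBr : ∀ p q : g × h, Br p q = (⁅p.1, q.1⁆, ψ p.1 q.1))
    (Φ : g × h → g × h)
    (hΦ : ∀ p : g × h, Φ p = (φg p.1, χ p.1 + φh p.2)) :
    ((∀ p q r : g × h, Br (Br p q) r + Br (Br q r) p + Br (Br r p) q = 0) ∧
      (∀ p q : g × h, Φ (Br p q) = Br (Φ p) q + Br p (Φ q)))
    ↔
    ((∀ x y z : g, ψ ⁅x, y⁆ z + ψ ⁅y, z⁆ x + ψ ⁅z, x⁆ y = 0) ∧
      (∀ x y : g, χ ⁅x, y⁆ + φh (ψ x y) - ψ (φg x) y - ψ x (φg y) = 0)) := by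
  have jacobi (x y z : g) : ⁅⁅x, y⁆, z⁆ + ⁅⁅y, z⁆, x⁆ + ⁅⁅z, x⁆, y⁆ = 0 := by
    rw [← neg_eq_zero, neg_add, neg_add, lie_skew, lie_skew, lie_skew, ← lie_jacobi x y z]
    abel
  simp only [hBr, hΦ, Prod.mk_add_mk, Prod.mk_eq_zero, Prod.mk.injEq, jacobi, hφg, true_and,
    sub_sub, sub_eq_zero]
  exact and_congr ⟨fun H x y z => H (x, 0) (y, 0) (z, 0), fun H p q r => H p.1 q.1 r.1⟩
    ⟨fun H x y => H (x, 0) (y, 0), fun H p q => H p.1 q.1⟩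
end

section
/- Let (ĝ, φ_ĝ) be a central extension of a LieDer pair (g, φ_g) by an abelian LieDer pair (h, φ_h), with projection p : ĝ → g a morphism of LieDer pairs whose kernel is h, [h, ĝ]_ĝ = 0, and φ_ĝ|_h = φ_h. Let s_1, s_2 : g → ĝ be two linear sections (p ∘ s_i = id_g), and for i = 1,2 define ψ_i(x,y) = [s_i(x), s_i(y)]_ĝ − s_i([x,y]_g) and χ_i(x) = φ_ĝ(s_i(x)) − s_i(φ_g(x)), which take values in h. Then with ϕ = s_1 − s_2 : g → h one has ψ_1(x,y) = ψ_2(x,y) − ϕ([x,y]_g) and χ_1(x) = χ_2(x) + φ_h(ϕ(x)) − ϕ(φ_g(x)) for all x,y ∈ g; that is, (ψ_1, χ_1) − (ψ_2, χ_2) = ∂(ϕ), so the cohomology class of (ψ, χ) in H²_{LieDer}(g; h) with trivial coefficients does not depend on the choice of section. -/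
/-- Let `(ĝ, φĝ)` be a central extension of a LieDer pair `(g, φg)` by an
abelian LieDer pair `(h, φh)`, where `h = ker p` and `φh = φĝ|_h`.  For two linear
sections `s₁, s₂` of `p` define `ψᵢ(x,y) = ⁅sᵢx, sᵢy⁆ − sᵢ[x,y]` and
`χᵢ(x) = φĝ(sᵢx) − sᵢ(φg x)` (both take values in `h`).  Then with `ϕ = s₁ − s₂`:
`ψ₁(x,y) = ψ₂(x,y) − ϕ([x,y])` and `χ₁(x) = χ₂(x) + φh(ϕ(x)) − ϕ(φg(x))`, i.e.
`(ψ₁, χ₁) − (ψ₂, χ₂) = ∂(ϕ)`, so the class of `(ψ, χ)` in `H²_{LieDer}(g; h)` does not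
depend on the choice of section. -/
theorem central_extension_class_well_defined {K gh g : Type*} [Field K] [CharZero K]
    [LieRing gh] [LieAlgebra K gh] [LieRing g] [LieAlgebra K g]
    (p : gh →ₗ⁅K⁆ g) (hsurj : Function.Surjective p)
    (hcentral : ∀ v w : gh, p v = 0 → ⁅v, w⁆ = 0)
    (φgh : gh →ₗ[K] gh) (hφgh : ∀ t t' : gh, φgh ⁅t, t'⁆ = ⁅φgh t, t'⁆ + ⁅t, φgh t'⁆)
    (φg : g →ₗ[K] g) (hφg : ∀ x y : g, φg ⁅x, y⁆ = ⁅φg x, y⁆ + ⁅x, φg y⁆)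
    (hmor : ∀ t : gh, p (φgh t) = φg (p t))
    (s₁ s₂ : g →ₗ[K] gh) (hs₁ : ∀ x, p (s₁ x) = x) (hs₂ : ∀ x, p (s₂ x) = x) :
    -- ψ₁ and χ₁ take values in h = ker p
    (∀ x y : g, p (⁅s₁ x, s₁ y⁆ - s₁ ⁅x, y⁆) = 0) ∧
    (∀ x : g, p (φgh (s₁ x) - s₁ (φg x)) = 0) ∧
    -- ψ₁ = ψ₂ − ϕ ∘ [·,·]  where ϕ = s₁ − s₂
    (∀ x y : g, ⁅s₁ x, s₁ y⁆ - s₁ ⁅x, y⁆ =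
      (⁅s₂ x, s₂ y⁆ - s₂ ⁅x, y⁆) - (s₁ ⁅x, y⁆ - s₂ ⁅x, y⁆)) ∧
    -- χ₁ = χ₂ + φh ∘ ϕ − ϕ ∘ φg
    (∀ x : g, φgh (s₁ x) - s₁ (φg x) =
      (φgh (s₂ x) - s₂ (φg x)) + φgh (s₁ x - s₂ x) - (s₁ (φg x) - s₂ (φg x))) := by
  have hdiff (x : g) : p (s₁ x - s₂ x) = 0 := by rw [map_sub, hs₁, hs₂, sub_self]
  have hbracket (x y : g) : ⁅s₁ x, s₁ y⁆ = ⁅s₂ x, s₂ y⁆ := by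
    have hleft : ⁅s₁ x, s₁ y⁆ = ⁅s₂ x, s₁ y⁆ := by
      rw [← sub_eq_zero, ← sub_lie, hcentral _ _ (hdiff x)]
    have hright : ⁅s₂ x, s₁ y⁆ = ⁅s₂ x, s₂ y⁆ := by
      rw [← sub_eq_zero, ← lie_sub, ← lie_skew, hcentral _ _ (hdiff y), neg_zero]
    exact hleft.trans hright
  refine ⟨fun x y => ?_, fun x => ?_, fun x y => ?_, fun x => ?_⟩
  · rw [map_sub, LieHom.map_lie, hs₁, hs₁, hs₁, sub_self]
  · rw [map_sub, hmor, hs₁, hs₁, sub_self]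
  · rw [hbracket]
    abel
  · rw [map_sub]
    abel
end

section
/- Let 0 → h → ĝ →p→ g → 0 be a central extension of Lie algebras over a field K of characteristic 0 (p surjective with kernel h and [h, ĝ]_ĝ = 0), let s : g → ĝ be a linear section of p, and set ψ(x,y) = [s(x), s(y)]_ĝ − s([x,y]_g) ∈ h. For any derivation φ_g of g and any linear map φ_h : h → h, define Ob(x,y) = φ_h(ψ(x,y)) − ψ(φ_g(x), y) − ψ(x, φ_g(y)). Then: (1) Ob is a 2-cocycle of g with coefficients in the trivial representation on h, i.e. Ob([x,y]_g, z) + Ob([y,z]_g, x) + Ob([z,x]_g, y) = 0 for all x,y,z ∈ g; and (2) if s_1, s_2 are two sections with associated Ob¹, Ob² and ϕ = s_1 − s_2 : g → h, then Ob¹(x,y) = Ob²(x,y) − (φ_h ∘ ϕ − ϕ ∘ φ_g)([x,y]_g), so the class of Ob in H²(g; h) does not depend on the section. -/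
/-- The Jacobi identity for left-nested brackets. -/
theorem lie_lie_cyclic_sum {L : Type*} [LieRing L] (a b c : L) :
    ⁅⁅a, b⁆, c⁆ + ⁅⁅b, c⁆, a⁆ + ⁅⁅c, a⁆, b⁆ = 0 := by
  rw [← lie_skew ⁅a, b⁆ c, ← lie_skew ⁅b, c⁆ a, ← lie_skew ⁅c, a⁆ b, ← neg_add, ← neg_add,
    neg_eq_zero, ← lie_jacobi a b c]
  abel

section

variable {K gh g : Type*} [Field K] [LieRing gh] [LieAlgebra K gh] [LieRing g] [LieAlgebra K g]
  {p : gh →ₗ⁅K⁆ g} {s : g →ₗ[K] gh} {ψ : g → g → LinearMap.ker p.toLinearMap}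

/-- The curvature of a linear section is additive in its first argument. -/
theorem section_curvature_add_left
    (hψ : ∀ x y : g, (ψ x y : gh) = ⁅s x, s y⁆ - s ⁅x, y⁆) (x x' y : g) :
    ψ (x + x') y = ψ x y + ψ x' y := by
  apply Subtype.ext
  simp only [Submodule.coe_add, hψ, map_add, add_lie]
  abel

/-- The curvature of a linear section of a central extension is a 2-cocycle. -/
theorem section_curvature_cocycle
    (hcentral : ∀ v w : gh, p v = 0 → ⁅v, w⁆ = 0)
    (hψ : ∀ x y : g, (ψ x y : gh) = ⁅s x, s y⁆ - s ⁅x, y⁆) (x y z : g) :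
    ψ ⁅x, y⁆ z + ψ ⁅y, z⁆ x + ψ ⁅z, x⁆ y = 0 := by
  have lie_section (a b c : g) : ⁅s ⁅a, b⁆, s c⁆ = ⁅⁅s a, s b⁆, s c⁆ := by
    have h := hcentral (ψ a b) (s c) (ψ a b).2
    rw [hψ, sub_lie, sub_eq_zero] at h
    exact h.symm
  apply Subtype.ext
  simp only [Submodule.coe_add, Submodule.coe_zero, hψ, lie_section]
  have h := congrArg s (lie_lie_cyclic_sum x y z)
  simp only [map_add, map_zero] at h
  linear_combination (norm := abel) lie_lie_cyclic_sum (s x) (s y) (s z) - h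

/-- Changing the section changes its curvature by the coboundary of the difference. -/
theorem section_curvature_sub
    (hcentral : ∀ v w : gh, p v = 0 → ⁅v, w⁆ = 0)
    {s' : g →ₗ[K] gh} {ψ' : g → g → LinearMap.ker p.toLinearMap}
    (hψ : ∀ x y : g, (ψ x y : gh) = ⁅s x, s y⁆ - s ⁅x, y⁆)
    (hψ' : ∀ x y : g, (ψ' x y : gh) = ⁅s' x, s' y⁆ - s' ⁅x, y⁆)
    {ϕ : g → LinearMap.ker p.toLinearMap} (hϕ : ∀ x : g, (ϕ x : gh) = s x - s' x) (x y : g) :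
    ψ x y = ψ' x y - ϕ ⁅x, y⁆ := by
  have h (a b : g) : ⁅s a, s b⁆ = ⁅s' a, s b⁆ := by
    have := hcentral (ϕ a) (s b) (ϕ a).2
    rwa [hϕ, sub_lie, sub_eq_zero] at this
  have h' : ⁅s' x, s y⁆ = ⁅s' x, s' y⁆ := by
    have := hcentral (ϕ y) (s' x) (ϕ y).2
    rw [hϕ, sub_lie, sub_eq_zero] at this
    rw [← lie_skew, this, lie_skew]
  apply Subtype.ext
  simp only [Submodule.coe_sub, hψ, hψ', hϕ, h x y, h']
  abel

end


/-- Let `0 → h → ĝ →p→ g → 0` be a central extension of Lie algebras over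
a field `K` of characteristic `0` (here `h = ker p`), `s` a linear section of `p`, and
`ψ(x,y) = ⁅s x, s y⁆ − s[x,y] ∈ h`.  For a derivation `φg` of `g` and a linear map
`φh : h → h`, let `Ob(x,y) = φh(ψ(x,y)) − ψ(φg x, y) − ψ(x, φg y)`.  Then (1) `Ob` is a
2-cocycle of `g` with trivial coefficients in `h`, and (2) for two sections `s₁, s₂`
with `ϕ = s₁ − s₂ : g → h`, `Ob¹(x,y) = Ob²(x,y) − (φh∘ϕ − ϕ∘φg)([x,y])`, so the class
`[Ob] ∈ H²(g; h)` does not depend on the section. -/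
theorem obstruction_class_of_derivation_pair {K gh g : Type*} [Field K] [CharZero K]
    [LieRing gh] [LieAlgebra K gh] [LieRing g] [LieAlgebra K g]
    (p : gh →ₗ⁅K⁆ g) (hsurj : Function.Surjective p)
    (hcentral : ∀ v w : gh, p v = 0 → ⁅v, w⁆ = 0)
    (φg : g →ₗ[K] g) (hφg : ∀ x y : g, φg ⁅x, y⁆ = ⁅φg x, y⁆ + ⁅x, φg y⁆)
    (φh : LinearMap.ker p.toLinearMap →ₗ[K] LinearMap.ker p.toLinearMap)
    (s₁ s₂ : g →ₗ[K] gh) (hs₁ : ∀ x, p (s₁ x) = x) (hs₂ : ∀ x, p (s₂ x) = x)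
    (ψ₁ ψ₂ : g → g → LinearMap.ker p.toLinearMap)
    (hψ₁ : ∀ x y : g, (ψ₁ x y : gh) = ⁅s₁ x, s₁ y⁆ - s₁ ⁅x, y⁆)
    (hψ₂ : ∀ x y : g, (ψ₂ x y : gh) = ⁅s₂ x, s₂ y⁆ - s₂ ⁅x, y⁆)
    (Ob₁ Ob₂ : g → g → LinearMap.ker p.toLinearMap)
    (hOb₁ : ∀ x y : g, Ob₁ x y = φh (ψ₁ x y) - ψ₁ (φg x) y - ψ₁ x (φg y))
    (hOb₂ : ∀ x y : g, Ob₂ x y = φh (ψ₂ x y) - ψ₂ (φg x) y - ψ₂ x (φg y))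
    (ϕ : g → LinearMap.ker p.toLinearMap)
    (hϕ : ∀ x : g, (ϕ x : gh) = s₁ x - s₂ x) :
    -- (1) Ob is a 2-cocycle with trivial coefficients
    (∀ x y z : g, Ob₁ ⁅x, y⁆ z + Ob₁ ⁅y, z⁆ x + Ob₁ ⁅z, x⁆ y = 0) ∧
    -- (2) the class of Ob does not depend on the section
    (∀ x y : g, Ob₁ x y = Ob₂ x y - (φh (ϕ ⁅x, y⁆) - ϕ (φg ⁅x, y⁆))) := by
  refine ⟨fun x y z => ?_, fun x y => ?_⟩
  · have hc := section_curvature_cocycle hcentral hψ₁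
    have hφ := congrArg φh (hc x y z)
    simp only [map_add, map_zero] at hφ
    simp only [hOb₁, hφg, section_curvature_add_left hψ₁]
    linear_combination (norm := abel) hφ - hc (φg x) y z - hc x (φg y) z - hc x y (φg z)
  · have hϕ_add (a b : g) : ϕ (a + b) = ϕ a + ϕ b := by
      apply Subtype.ext
      simp only [Submodule.coe_add, hϕ, map_add]
      abel
    simp only [hOb₁, hOb₂, section_curvature_sub hcentral hψ₁ hψ₂ hϕ, map_sub, hφg, hϕ_add]
    abel
end

section
/- Let 0 → h → ĝ →p→ g → 0 be a central extension of Lie algebras over a field K of characteristic 0, let s : g → ĝ be a linear section of p, and set ψ(x,y) = [s(x), s(y)]_ĝ − s([x,y]_g) ∈ h. Let φ_g be a derivation of g and φ_h : h → h a linear map. Then the pair (φ_h, φ_g) is extensible — i.e. there exists a derivation φ_ĝ of ĝ with p ∘ φ_ĝ = φ_g ∘ p and φ_ĝ|_h = φ_h — if and only if there exists a linear map λ : g → h such that φ_h(ψ(x,y)) − ψ(φ_g(x), y) − ψ(x, φ_g(y)) = −λ([x,y]_g) for all x,y ∈ g, i.e. the obstruction 2-cocycle Ob(x,y) = φ_h(ψ(x,y))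 − ψ(φ_g(x), y) − ψ(x, φ_g(y)) is a coboundary. -/
/-- If the kernel of `p` is central, the bracket of two elements depends only on their images
under `p`. -/
theorem lie_eq_lie_of_map_eq {K L M : Type*} [CommRing K]
    [LieRing L] [LieAlgebra K L] [LieRing M] [LieAlgebra K M] (p : L →ₗ⁅K⁆ M)
    (hcentral : ∀ v w : L, p v = 0 → ⁅v, w⁆ = 0) {a a' b b' : L}
    (ha : p a = p a') (hb : p b = p b') : ⁅a, b⁆ = ⁅a', b'⁆ := by
  have h₁ := hcentral (a - a') b (by simp [ha])
  have h₂ := hcentral (b - b') a' (by simp [hb])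
  rw [sub_lie, sub_eq_zero] at h₁ h₂
  rw [h₁, ← lie_skew, h₂, lie_skew]

/-- Let `0 → h → ĝ →p→ g → 0` be a central extension of Lie algebras over
a field `K` of characteristic `0` (here `h = ker p`), `s` a linear section of `p`, and
`ψ(x,y) = ⁅s x, s y⁆ − s[x,y] ∈ h`.  Let `φg` be a derivation of `g` and `φh : h → h`
linear.  Then `(φh, φg)` is extensible (there is a derivation `φĝ` of `ĝ` with
`p ∘ φĝ = φg ∘ p` and `φĝ|_h = φh`) if and only if there exists a linear `λ : g → h`
with `φh(ψ(x,y)) − ψ(φg x, y) − ψ(x, φg y) = −λ([x,y])`, i.e. the obstruction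
2-cocycle is a coboundary. -/
theorem derivation_pair_extensible_iff {K gh g : Type*} [Field K] [CharZero K]
    [LieRing gh] [LieAlgebra K gh] [LieRing g] [LieAlgebra K g]
    (p : gh →ₗ⁅K⁆ g) (hsurj : Function.Surjective p)
    (hcentral : ∀ v w : gh, p v = 0 → ⁅v, w⁆ = 0)
    (s : g →ₗ[K] gh) (hs : ∀ x, p (s x) = x)
    (ψ : g → g → LinearMap.ker p.toLinearMap)
    (hψ : ∀ x y : g, (ψ x y : gh) = ⁅s x, s y⁆ - s ⁅x, y⁆)
    (φg : g →ₗ[K] g) (hφg : ∀ x y : g, φg ⁅x, y⁆ = ⁅φg x, y⁆ + ⁅x, φg y⁆)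
    (φh : LinearMap.ker p.toLinearMap →ₗ[K] LinearMap.ker p.toLinearMap) :
    (∃ φgh : gh →ₗ[K] gh,
      (∀ t t' : gh, φgh ⁅t, t'⁆ = ⁅φgh t, t'⁆ + ⁅t, φgh t'⁆) ∧
      (∀ t : gh, p (φgh t) = φg (p t)) ∧
      (∀ v : LinearMap.ker p.toLinearMap, φgh (v : gh) = (φh v : gh)))
    ↔
    (∃ lam : g →ₗ[K] LinearMap.ker p.toLinearMap,
      ∀ x y : g, φh (ψ x y) - ψ (φg x) y - ψ x (φg y) = - lam ⁅x, y⁆) := by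
  have hlie {a a' b b' : gh} (ha : p a = p a') (hb : p b = p b') : ⁅a, b⁆ = ⁅a', b'⁆ :=
    lie_eq_lie_of_map_eq p hcentral ha hb
  have hker (v : LinearMap.ker p.toLinearMap) : p v = 0 := v.2
  constructor
  · rintro ⟨φ, hder, hp, hres⟩
    refine ⟨(φ ∘ₗ s - s ∘ₗ φg).codRestrict _ fun x => ?_, fun x y => Subtype.ext ?_⟩
    · simp [hp, hs]
    · have h₁ : ⁅φ (s x), s y⁆ = ⁅s (φg x), s y⁆ := hlie (by simp [hp, hs]) rfl
      have h₂ : ⁅s x, φ (s y)⁆ = ⁅s x, s (φg y)⁆ := hlie rfl (by simp [hp, hs])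
      have hφψ : (φh (ψ x y) : gh) = ⁅s (φg x), s y⁆ + ⁅s x, s (φg y)⁆ - φ (s ⁅x, y⁆) := by
        rw [← hres, hψ, map_sub, hder, h₁, h₂]
      simp only [Submodule.coe_sub, Submodule.coe_neg, LinearMap.codRestrict_apply,
        LinearMap.sub_apply, LinearMap.comp_apply, hφψ, hψ, hφg, map_add]
      abel
  · rintro ⟨lam, hlam⟩
    let r : gh →ₗ[K] LinearMap.ker p.toLinearMap :=
      (LinearMap.id - s ∘ₗ p.toLinearMap).codRestrict _ fun t => by simp [hs]
    let φ : gh →ₗ[K] gh := s ∘ₗ φg ∘ₗ p.toLinearMap +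
      (LinearMap.ker p.toLinearMap).subtype ∘ₗ (lam ∘ₗ p.toLinearMap + φh ∘ₗ r)
    have hφ (t : gh) : φ t = s (φg (p t)) + (lam (p t) + φh (r t) : gh) := rfl
    have hpφ (t : gh) : p (φ t) = φg (p t) := by simp [hφ, hs, hker]
    refine ⟨φ, fun t t' => ?_, hpφ, fun v => ?_⟩
    · have hr : r ⁅t, t'⁆ = ψ (p t) (p t') := by
        apply Subtype.ext
        have h : ⁅t, t'⁆ = ⁅s (p t), s (p t')⁆ := hlie (by simp [hs]) (by simp [hs])
        rw [hψ, ← h, ← LieHom.map_lie]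
        rfl
      have h₁ : ⁅φ t, t'⁆ = ⁅s (φg (p t)), s (p t')⁆ :=
        hlie (by simp [hpφ, hs]) (by simp [hs])
      have h₂ : ⁅t, φ t'⁆ = ⁅s (p t), s (φg (p t'))⁆ :=
        hlie (by simp [hs]) (by simp [hpφ, hs])
      have hob := congrArg Subtype.val (hlam (p t) (p t'))
      simp only [Submodule.coe_sub, Submodule.coe_neg, hψ] at hob
      rw [h₁, h₂, hφ, hr, LieHom.map_lie, hφg, map_add, ← sub_eq_zero]
      rw [← sub_eq_zero] at hob
      rw [← hob]
      abel
    · have hr : r v = v := Subtype.ext (by simp [r, hker])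
      simp [hφ, hr, hker]
end

section
/- Let g be a Lie algebra and h a vector space (viewed as an abelian Lie algebra), both over a field K of characteristic 0, let φ_g be a derivation of g and φ_h : h → h a linear map. Then (φ_h, φ_g) is extensible in every central extension of g by h — i.e. for every Lie bracket on g ⊕ h of the form [x+u, y+v] = [x,y]_g + ψ(x,y) with ψ a 2-cocycle, there is a derivation of this Lie algebra projecting to φ_g and restricting to φ_h on h — if and only if for every 2-cocycle ψ : g × g → h (skew-symmetric bilinear with ψ([x,y]_g, z) + ψ([y,z]_g, x) + ψ([z,x]_g, y) = 0) there exists a linear map λ : g → h such that φ_h(ψ(x,y)) − ψ(φ_g(x), y) − ψ(x, φ_g(y)) = −λ([x,y]_g) for all x,y ∈ g, i.e. the induced map Θ(φ_h, φ_g) on H²(g; h) is zero. -/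
/-- Let `g` be a Lie algebra and `h` a vector space (an abelian Lie
algebra) over a field `K` of characteristic `0`, `φg` a derivation of `g` and
`φh : h → h` linear.  Then `(φh, φg)` is extensible in every central extension of `g`
by `h` (for every 2-cocycle `ψ`, the Lie algebra `g ⊕ h` with bracket
`[x+u, y+v] = [x,y]_g + ψ(x,y)` admits a derivation projecting to `φg` and restricting
to `φh` on `h`) if and only if for every 2-cocycle `ψ` the obstruction
`φh(ψ(x,y)) − ψ(φg x, y) − ψ(x, φg y)` is a coboundary `−λ([x,y])`, i.e. the induced
map `Θ(φh, φg)` on `H²(g; h)` is zero. -/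
theorem extensible_in_every_central_extension_iff {K g h : Type*} [Field K] [CharZero K]
    [LieRing g] [LieAlgebra K g] [AddCommGroup h] [Module K h]
    (φg : g →ₗ[K] g) (hφg : ∀ x y : g, φg ⁅x, y⁆ = ⁅φg x, y⁆ + ⁅x, φg y⁆)
    (φh : h →ₗ[K] h) :
    (∀ ψ : g →ₗ[K] g →ₗ[K] h, (∀ x y : g, ψ x y = - ψ y x) →
      (∀ x y z : g, ψ ⁅x, y⁆ z + ψ ⁅y, z⁆ x + ψ ⁅z, x⁆ y = 0) →
      ∀ Br : g × h → g × h → g × h,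
        (∀ p q : g × h, Br p q = (⁅p.1, q.1⁆, ψ p.1 q.1)) →
      ∃ D : g × h →ₗ[K] g × h,
        (∀ p q : g × h, D (Br p q) = Br (D p) q + Br p (D q)) ∧
        (∀ p : g × h, (D p).1 = φg p.1) ∧
        (∀ u : h, D (0, u) = (0, φh u)))
    ↔
    (∀ ψ : g →ₗ[K] g →ₗ[K] h, (∀ x y : g, ψ x y = - ψ y x) →
      (∀ x y z : g, ψ ⁅x, y⁆ z + ψ ⁅y, z⁆ x + ψ ⁅z, x⁆ y = 0) →
      ∃ lam : g →ₗ[K] h,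
        ∀ x y : g, φh (ψ x y) - ψ (φg x) y - ψ x (φg y) = - lam ⁅x, y⁆) := by
  constructor
  · intro H ψ hskew hcocycle
    obtain ⟨D, hD, hDg, hDh⟩ := H ψ hskew hcocycle _ fun _ _ => rfl
    refine ⟨LinearMap.snd K g h ∘ₗ D ∘ₗ LinearMap.inl K g h, fun x y => ?_⟩
    have hderiv := congrArg Prod.snd (hD (x, 0) (y, 0))
    have hsplit : D (⁅x, y⁆, ψ x y) = D (⁅x, y⁆, 0) + D (0, ψ x y) := by
      rw [← map_add, Prod.mk_add_mk, add_zero, zero_add]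
    simp only [hsplit, hDh, hDg, Prod.snd_add] at hderiv
    simp only [LinearMap.comp_apply, LinearMap.inl_apply, LinearMap.snd_apply]
    rw [sub_sub, ← hderiv]
    abel
  · intro H ψ hskew hcocycle Br hBr
    obtain ⟨lam, hlam⟩ := H ψ hskew hcocycle
    refine ⟨(φg ∘ₗ LinearMap.fst K g h).prod (lam.coprod φh), fun p q => ?_, fun p => rfl,
      fun u => by simp⟩
    simp only [hBr, LinearMap.prod_apply, Function.prod, LinearMap.comp_apply, LinearMap.fst_apply,
      LinearMap.coprod_apply, Prod.mk_add_mk, Prod.mk.injEq]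
    refine ⟨hφg _ _, ?_⟩
    have h := hlam p.1 q.1
    rw [sub_sub, sub_eq_iff_eq_add] at h
    rw [h]
    abel
end
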